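/- Let 1 < p < 2 with conjugate exponent p', and let p' ≤ q ≤ ∞. Suppose X is a (real or complex) Banach space containing a complemented copy of ℓ_p, and Y is a Banach space containing an isomorphic copy of ℓ_q if q < ∞, or of c₀ if q = ∞. Then there exist operators S, T ∈ L(X,Y) such that: S is finitely strictly singular but does not lie in the closed linear span of the operators from X to Y factoring through ℓ₂; and T factors through ℓ₂ but is not finitely strictly singular. Consequently the closed subideals of L(X,Y) are not linearly ordered by inclusion. -/

import Mathlib

open scoped ENNReal

noncomputable section

def FinStrictSing {𝕜 X Y : Type*} [NontriviallyNormedField 𝕜]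
    [NormedAddCommGroup X] [NormedSpace 𝕜 X] [NormedAddCommGroup Y] [NormedSpace 𝕜 Y]
    (T : X →L[𝕜] Y) : Prop :=
  ∀ ε : ℝ, 0 < ε → ∃ n : ℕ, ∀ E : Submodule 𝕜 X, Module.finrank 𝕜 E = n →
    ∃ x ∈ E, x ≠ 0 ∧ ‖T x‖ < ε * ‖x‖

/-- `T` factors through the Hilbert space `ℓ₂`. -/
def FactorsThroughEllTwo {𝕜 X Y : Type*} [RCLike 𝕜]
    [NormedAddCommGroup X] [NormedSpace 𝕜 X] [NormedAddCommGroup Y] [NormedSpace 𝕜 Y]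
    (T : X →L[𝕜] Y) : Prop :=
  ∃ (A : X →L[𝕜] lp (fun _ : ℕ => 𝕜) 2) (B : lp (fun _ : ℕ => 𝕜) 2 →L[𝕜] Y), T = B.comp A

/-- The closed linear span of the operators `X → Y` factoring through `ℓ₂`. -/
def closedSpanHilbertFactorable (𝕜 X Y : Type*) [RCLike 𝕜]
    [NormedAddCommGroup X] [NormedSpace 𝕜 X] [NormedAddCommGroup Y] [NormedSpace 𝕜 Y] :
    Submodule 𝕜 (X →L[𝕜] Y) :=
  (Submodule.span 𝕜 {T : X →L[𝕜] Y | FactorsThroughEllTwo T}).topologicalClosure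

/-- `I` is a closed subideal of `L(X,Y)`. -/
def IsClosedSubideal {𝕜 X Y : Type*} [RCLike 𝕜]
    [NormedAddCommGroup X] [NormedSpace 𝕜 X] [NormedAddCommGroup Y] [NormedSpace 𝕜 Y]
    (I : Submodule 𝕜 (X →L[𝕜] Y)) : Prop :=
  IsClosed (I : Set (X →L[𝕜] Y)) ∧
    ∀ T ∈ I, ∀ A : X →L[𝕜] X, ∀ B : Y →L[𝕜] Y, B.comp (T.comp A) ∈ I

/-- Rademacher signs on the cube `Finset (Fin k)`. -/
def rad {k : ℕ} (i : Fin k) (s : Finset (Fin k)) : ℝ := if i ∈ s then -1 else 1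

/-- Walsh matrix. -/
def wal {k : ℕ} (s t : Finset (Fin k)) : ℝ := ∏ i ∈ t, rad i s

lemma wal_symm {k : ℕ} (s t : Finset (Fin k)) : wal s t = wal t s := by
  unfold wal rad
  rw [Finset.prod_ite, Finset.prod_ite]
  simp only [Finset.prod_const_one, mul_one, Finset.prod_const]
  congr 2
  ext i
  simp [and_comm]

lemma wal_singleton {k : ℕ} (s : Finset (Fin k)) (i : Fin k) : wal s {i} = rad i s := by
  simp [wal]

lemma abs_rad {k : ℕ} (i : Fin k) (s : Finset (Fin k)) : |rad i s| = 1 := by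
  unfold rad; split_ifs <;> simp

lemma rad_mul_self {k : ℕ} (i : Fin k) (s : Finset (Fin k)) : rad i s * rad i s = 1 := by
  unfold rad; split_ifs <;> simp

lemma abs_wal {k : ℕ} (s t : Finset (Fin k)) : |wal s t| = 1 := by
  unfold wal
  rw [Finset.abs_prod]
  simp [abs_rad]

lemma wal_orth {k : ℕ} (s s' : Finset (Fin k)) :
    ∑ t, wal s t * wal s' t = if s = s' then (2 : ℝ) ^ k else 0 := by
  have h : ∑ t, wal s t * wal s' t = ∏ i : Fin k, (1 + rad i s * rad i s') := by
    rw [Finset.prod_one_add]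
    simp [wal, Finset.prod_mul_distrib]
  rw [h]
  split_ifs with hs
  · subst hs
    simp only [rad_mul_self]
    norm_num
  · have : ∃ i, ¬ (i ∈ s ↔ i ∈ s') := by
      by_contra hc
      push Not at hc
      exact hs (Finset.ext hc)
    obtain ⟨i, hi⟩ := this
    apply Finset.prod_eq_zero (Finset.mem_univ i)
    unfold rad
    by_cases h1 : i ∈ s <;> by_cases h2 : i ∈ s' <;> simp_all

lemma wal_orth' {k : ℕ} (t t' : Finset (Fin k)) :
    ∑ s, wal s t * wal s t' = if t = t' then (2 : ℝ) ^ k else 0 := by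
  rw [← wal_orth t t']
  exact Finset.sum_congr rfl fun s _ => by rw [wal_symm s t, wal_symm s t']

lemma rad_orth {k : ℕ} (i j : Fin k) :
    ∑ s, rad i s * rad j s = if i = j then (2 : ℝ) ^ k else 0 := by
  have := wal_orth' (k := k) {i} {j}
  simpa [wal_singleton, Finset.singleton_inj] using this

/-- orthogonality in an inner product space -/
lemma orth_parseval {𝕜 H : Type*} [RCLike 𝕜] [NormedAddCommGroup H] [InnerProductSpace 𝕜 H]
    {α β : Type*} [Fintype α] [Fintype β] [DecidableEq β] (c : α → β → ℝ) (n : ℝ)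
    (hc : ∀ t t', ∑ s, c s t * c s t' = if t = t' then n else 0) (h : β → H) :
    ∑ s, ‖∑ t, (c s t : 𝕜) • h t‖ ^ 2 = n * ∑ t, ‖h t‖ ^ 2 := by
  have key : ∀ s, ((‖∑ t, (c s t : 𝕜) • h t‖ ^ 2 : ℝ) : 𝕜)
      = ∑ t, ∑ t', ((c s t * c s t' : ℝ) : 𝕜) * inner 𝕜 (h t) (h t') := by
    intro s
    push_cast
    rw [← inner_self_eq_norm_sq_to_K (𝕜 := 𝕜), sum_inner]
    refine Finset.sum_congr rfl fun t _ => ?_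
    rw [inner_sum]
    refine Finset.sum_congr rfl fun t' _ => ?_
    rw [inner_smul_left, inner_smul_right]
    simp [mul_assoc]
  have : ((∑ s, ‖∑ t, (c s t : 𝕜) • h t‖ ^ 2 : ℝ) : 𝕜) = ((n * ∑ t, ‖h t‖ ^ 2 : ℝ) : 𝕜) := by
    rw [RCLike.ofReal_sum]
    simp_rw [key]
    rw [Finset.sum_comm]
    have e : ∀ t, ∑ s, ∑ t', ((c s t * c s t' : ℝ) : 𝕜) * inner 𝕜 (h t) (h t')
        = (n : 𝕜) * (‖h t‖ ^ 2 : 𝕜) := by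
      intro t
      rw [Finset.sum_comm]
      have : ∀ t', ∑ s, ((c s t * c s t' : ℝ) : 𝕜) * inner 𝕜 (h t) (h t')
          = if t = t' then (n : 𝕜) * inner 𝕜 (h t) (h t') else 0 := by
        intro t'
        rw [← Finset.sum_mul, ← RCLike.ofReal_sum, hc]
        split_ifs <;> simp
      simp_rw [this]
      simp [inner_self_eq_norm_sq_to_K]
    simp_rw [e]
    push_cast
    rw [Finset.mul_sum]
  exact_mod_cast this

lemma wal_parseval {𝕜 H : Type*} [RCLike 𝕜] [NormedAddCommGroup H] [InnerProductSpace 𝕜 H]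
    {k : ℕ} (h : Finset (Fin k) → H) :
    ∑ s, ‖∑ t, (wal s t : 𝕜) • h t‖ ^ 2 = 2 ^ k * ∑ t, ‖h t‖ ^ 2 :=
  orth_parseval _ _ wal_orth' h

lemma rad_parseval {𝕜 H : Type*} [RCLike 𝕜] [NormedAddCommGroup H] [InnerProductSpace 𝕜 H]
    {k : ℕ} (h : Fin k → H) :
    ∑ s, ‖∑ i, (rad i s : 𝕜) • h i‖ ^ 2 = 2 ^ k * ∑ i, ‖h i‖ ^ 2 :=
  orth_parseval (fun s i => rad i s) _ rad_orth h

lemma rad_exp {k : ℕ} (a : Fin k → ℝ) :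
    ∑ s, Real.exp (∑ i, rad i s * a i) ≤ 2 ^ k * Real.exp ((∑ i, a i ^ 2) / 2) := by
  have h1 : ∑ s, Real.exp (∑ i, rad i s * a i)
      = ∏ i, (Real.exp (-a i) + Real.exp (a i)) := by
    rw [Finset.prod_add]
    rw [Finset.powerset_univ]
    refine Finset.sum_congr rfl fun s _ => ?_
    rw [Real.exp_sum, ← Finset.prod_sdiff (Finset.subset_univ s), mul_comm]
    congr 1
    · refine Finset.prod_congr rfl fun i hi => ?_
      simp [rad, hi]
    · refine Finset.prod_congr rfl fun i hi => ?_
      simp only [Finset.mem_sdiff, Finset.mem_univ, true_and] at hi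
      simp [rad, hi]
  rw [h1]
  have h2 : ∀ i, Real.exp (-a i) + Real.exp (a i) ≤ 2 * Real.exp (a i ^ 2 / 2) := by
    intro i
    have := Real.cosh_le_exp_half_sq (a i)
    rw [Real.cosh_eq] at this
    linarith
  calc _ ≤ ∏ i, (2 * Real.exp (a i ^ 2 / 2)) := by
        apply Finset.prod_le_prod
        · intros; positivity
        · intros; exact h2 _
    _ = _ := by
        rw [Finset.prod_mul_distrib, ← Real.exp_sum, Finset.sum_div]
        simp

/-- a crude bound: powers are dominated by exponentials -/
lemma rpow_le_exp_const (r : ℝ) (hr : 0 ≤ r) : ∃ C : ℝ, 0 < C ∧ ∀ x : ℝ,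
    |x| ^ r ≤ C * (Real.exp x + Real.exp (-x)) := by
  obtain ⟨m, hm⟩ := exists_nat_ge r
  refine ⟨1 + m.factorial, by positivity, fun x => ?_⟩
  have hE : Real.exp |x| ≤ Real.exp x + Real.exp (-x) := by
    rcases abs_cases x with ⟨h, _⟩ | ⟨h, _⟩ <;> rw [h] <;>
      linarith [Real.exp_pos x, Real.exp_pos (-x)]
  have h1 : |x| ^ r ≤ 1 + |x| ^ m := by
    by_cases hx : |x| ≤ 1
    · have := Real.rpow_le_one (abs_nonneg x) hx hr
      have : 0 ≤ |x| ^ m := by positivity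
      linarith
    · have := Real.rpow_le_rpow_of_exponent_le (le_of_not_ge hx) hm
      rw [Real.rpow_natCast] at this
      linarith
  have h2 : |x| ^ m ≤ m.factorial * Real.exp |x| := by
    have := Real.pow_div_factorial_le_exp |x| (abs_nonneg x) m
    rw [div_le_iff₀ (by positivity)] at this
    linarith
  have h3 : 1 ≤ Real.exp |x| := Real.one_le_exp (abs_nonneg x)
  have h4 : (0:ℝ) ≤ m.factorial := by positivity
  nlinarith

/-- Khintchine, upper bound, real coefficients -/
lemma khinchin_upper_real (r : ℝ) (hr : 0 < r) : ∃ C : ℝ, 0 < C ∧ ∀ (k : ℕ) (a : Fin k → ℝ),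
    ∑ s, |∑ i, rad i s * a i| ^ r ≤ C * 2 ^ k * (∑ i, a i ^ 2) ^ (r / 2) := by
  obtain ⟨C, hC, h⟩ := rpow_le_exp_const r hr.le
  refine ⟨C * (2 * Real.exp (1/2)), by positivity, fun k a => ?_⟩
  by_cases ha : ∑ i, a i ^ 2 = 0
  · have h0 : ∀ i, a i = 0 := by
      intro i
      have := (Finset.sum_eq_zero_iff_of_nonneg (fun i _ => sq_nonneg (a i))).1 ha i (Finset.mem_univ i)
      simpa using this
    simp only [h0, mul_zero, Finset.sum_const_zero, abs_zero]
    rw [Real.zero_rpow hr.ne']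
    simp
    positivity
  have hpos : 0 < ∑ i, a i ^ 2 := lt_of_le_of_ne (Finset.sum_nonneg fun i _ => sq_nonneg _) (Ne.symm ha)
  set L := Real.sqrt (∑ i, a i ^ 2) with hL
  have hLpos : 0 < L := Real.sqrt_pos.2 hpos
  have hLsq : L ^ 2 = ∑ i, a i ^ 2 := Real.sq_sqrt hpos.le
  have hLr : (∑ i, a i ^ 2) ^ (r / 2) = L ^ r := by
    rw [← hLsq, ← Real.rpow_natCast, ← Real.rpow_mul hLpos.le]
    congr 1
    push_cast; ring
  set b : Fin k → ℝ := fun i => a i / L with hb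
  have hb1 : ∑ i, b i ^ 2 = 1 := by
    simp only [hb, div_pow]
    rw [← Finset.sum_div, ← hLsq, div_self]
    positivity
  have hab : ∀ s, |∑ i, rad i s * a i| ^ r = L ^ r * |∑ i, rad i s * b i| ^ r := by
    intro s
    have : ∑ i, rad i s * a i = L * ∑ i, rad i s * b i := by
      rw [Finset.mul_sum]
      refine Finset.sum_congr rfl fun i _ => ?_
      simp only [hb]; field_simp
    rw [this, abs_mul, abs_of_pos hLpos, Real.mul_rpow hLpos.le (abs_nonneg _)]
  rw [hLr]
  simp_rw [hab]
  rw [← Finset.mul_sum]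
  have e1 := rad_exp b
  have e2 := rad_exp (fun i => - b i)
  simp only [neg_sq, hb1, mul_neg, Finset.sum_neg_distrib] at e1 e2
  have : ∑ s, |∑ i, rad i s * b i| ^ r ≤ C * (2 ^ k * Real.exp (1/2) + 2 ^ k * Real.exp (1/2)) := by
    calc _ ≤ ∑ s, C * (Real.exp (∑ i, rad i s * b i) + Real.exp (-∑ i, rad i s * b i)) :=
          Finset.sum_le_sum fun s _ => h _
      _ = C * (∑ s, Real.exp (∑ i, rad i s * b i) + ∑ s, Real.exp (-∑ i, rad i s * b i)) := by
          rw [← Finset.mul_sum, Finset.sum_add_distrib]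
      _ ≤ _ := by gcongr
  calc _ ≤ L ^ r * (C * (2 ^ k * Real.exp (1/2) + 2 ^ k * Real.exp (1/2))) := by gcongr
    _ = _ := by ring

lemma rclike_norm_rpow_le {𝕜 : Type*} [RCLike 𝕜] (r : ℝ) (hr : 0 < r) (z : 𝕜) :
    ‖z‖ ^ r ≤ 2 ^ r * (|RCLike.re z| ^ r + |RCLike.im z| ^ r) := by
  have h1 : ‖z‖ ≤ 2 * max |RCLike.re z| |RCLike.im z| := by
    have : ‖z‖ ≤ |RCLike.re z| + |RCLike.im z| := by
      conv_lhs => rw [← RCLike.re_add_im z]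
      refine (norm_add_le _ _).trans ?_
      rw [norm_mul, RCLike.norm_ofReal, RCLike.norm_ofReal]
      have : ‖(RCLike.I : 𝕜)‖ ≤ 1 := by rw [RCLike.norm_I]; split_ifs <;> norm_num
      have := abs_nonneg (RCLike.im z)
      nlinarith
    have := le_max_left |RCLike.re z| |RCLike.im z|
    have := le_max_right |RCLike.re z| |RCLike.im z|
    linarith
  have h2 : (max |RCLike.re z| |RCLike.im z|) ^ r ≤ |RCLike.re z| ^ r + |RCLike.im z| ^ r := by
    have a1 : 0 ≤ |RCLike.re z| ^ r := by positivity
    have a2 : 0 ≤ |RCLike.im z| ^ r := by positivity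
    rcases max_choice |RCLike.re z| |RCLike.im z| with h | h <;> rw [h] <;> linarith
  calc ‖z‖ ^ r ≤ (2 * max |RCLike.re z| |RCLike.im z|) ^ r :=
        Real.rpow_le_rpow (norm_nonneg _) h1 hr.le
    _ = 2 ^ r * (max |RCLike.re z| |RCLike.im z|) ^ r := by
        rw [Real.mul_rpow (by norm_num) (by positivity)]
    _ ≤ _ := by gcongr

lemma re_sum_real_mul {𝕜 : Type*} [RCLike 𝕜] {α : Type*} [Fintype α] (c : α → ℝ) (a : α → 𝕜) :
    RCLike.re (∑ i, (c i : 𝕜) * a i) = ∑ i, c i * RCLike.re (a i) := by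
  rw [map_sum]; simp

lemma im_sum_real_mul {𝕜 : Type*} [RCLike 𝕜] {α : Type*} [Fintype α] (c : α → ℝ) (a : α → 𝕜) :
    RCLike.im (∑ i, (c i : 𝕜) * a i) = ∑ i, c i * RCLike.im (a i) := by
  rw [map_sum]; simp

/-- Khintchine, upper bound -/
lemma khinchin_upper (𝕜 : Type*) [RCLike 𝕜] (r : ℝ) (hr : 0 < r) :
    ∃ C : ℝ, 0 < C ∧ ∀ (k : ℕ) (a : Fin k → 𝕜),
    ∑ s, ‖∑ i, (rad i s : 𝕜) * a i‖ ^ r ≤ C * 2 ^ k * (∑ i, ‖a i‖ ^ 2) ^ (r / 2) := by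
  obtain ⟨C, hC, h⟩ := khinchin_upper_real r hr
  refine ⟨2 ^ r * (C + C), by positivity, fun k a => ?_⟩
  have e1 := h k (fun i => RCLike.re (a i))
  have e2 := h k (fun i => RCLike.im (a i))
  have m1 : (∑ i, (RCLike.re (a i)) ^ 2) ^ (r / 2) ≤ (∑ i, ‖a i‖ ^ 2) ^ (r / 2) := by
    apply Real.rpow_le_rpow (Finset.sum_nonneg fun i _ => sq_nonneg _) _ (by positivity)
    refine Finset.sum_le_sum fun i _ => ?_
    rw [← sq_abs]
    gcongr
    exact RCLike.abs_re_le_norm _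
  have m2 : (∑ i, (RCLike.im (a i)) ^ 2) ^ (r / 2) ≤ (∑ i, ‖a i‖ ^ 2) ^ (r / 2) := by
    apply Real.rpow_le_rpow (Finset.sum_nonneg fun i _ => sq_nonneg _) _ (by positivity)
    refine Finset.sum_le_sum fun i _ => ?_
    rw [← sq_abs (RCLike.im _)]
    gcongr
    exact RCLike.abs_im_le_norm _
  calc _ ≤ ∑ s : Finset (Fin k), 2 ^ r * (|∑ i, rad i s * RCLike.re (a i)| ^ r
          + |∑ i, rad i s * RCLike.im (a i)| ^ r) := by
        refine Finset.sum_le_sum fun s _ => ?_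
        rw [← re_sum_real_mul, ← im_sum_real_mul]
        exact rclike_norm_rpow_le r hr _
    _ = 2 ^ r * (∑ s : Finset (Fin k), |∑ i, rad i s * RCLike.re (a i)| ^ r
          + ∑ s : Finset (Fin k), |∑ i, rad i s * RCLike.im (a i)| ^ r) := by
        rw [← Finset.mul_sum, Finset.sum_add_distrib]
    _ ≤ 2 ^ r * (C * 2 ^ k * (∑ i, ‖a i‖ ^ 2) ^ (r / 2) + C * 2 ^ k * (∑ i, ‖a i‖ ^ 2) ^ (r / 2)) := by
        gcongr
        · exact e1.trans (by gcongr)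
        · exact e2.trans (by gcongr)
    _ = _ := by ring

/-- Khintchine, lower bound -/
lemma khinchin_lower (𝕜 : Type*) [RCLike 𝕜] (p : ℝ) (hp : 0 < p) (hp2 : p < 2) :
    ∃ C : ℝ, 0 < C ∧ ∀ (k : ℕ) (a : Fin k → 𝕜),
    2 ^ k * (∑ i, ‖a i‖ ^ 2) ^ (p / 2) ≤ C * ∑ s, ‖∑ i, (rad i s : 𝕜) * a i‖ ^ p := by
  obtain ⟨C, hC, h⟩ := khinchin_upper 𝕜 4 (by norm_num)
  -- K ^ 2 = 2 * C
  set K := Real.sqrt (2 * C) with hK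
  have hKpos : 0 < K := Real.sqrt_pos.2 (by positivity)
  have hKsq : K ^ 2 = 2 * C := Real.sq_sqrt (by positivity)
  refine ⟨2 * K ^ (2 - p), by positivity, fun k a => ?_⟩
  have hA0 : 0 ≤ ∑ i, ‖a i‖ ^ 2 := Finset.sum_nonneg fun i _ => by positivity
  rcases hA0.eq_or_lt with hA | hA
  · rw [← hA, Real.zero_rpow (by positivity), mul_zero]
    have : 0 ≤ ∑ s, ‖∑ i, (rad i s : 𝕜) * a i‖ ^ p := Finset.sum_nonneg fun i _ => by positivity
    positivity
  set L := Real.sqrt (∑ i, ‖a i‖ ^ 2) with hL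
  have hLpos : 0 < L := Real.sqrt_pos.2 hA
  have hLsq : L ^ 2 = ∑ i, ‖a i‖ ^ 2 := Real.sq_sqrt hA.le
  have hLr : ∀ r : ℝ, (∑ i, ‖a i‖ ^ 2) ^ (r / 2) = L ^ r := by
    intro r
    rw [← hLsq, ← Real.rpow_natCast, ← Real.rpow_mul hLpos.le]
    congr 1
    push_cast; ring
  have h4 := h k a
  have h2 := rad_parseval (𝕜 := 𝕜) a
  rw [hLr] at h4 ⊢
  simp only [smul_eq_mul] at h2
  rw [← hLsq] at h2
  set X : Finset (Fin k) → ℝ := fun s => ‖∑ i, (rad i s : 𝕜) * a i‖ with hX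
  have hX0 : ∀ s, 0 ≤ X s := fun s => norm_nonneg _
  change ∑ s, X s ^ (4 : ℝ) ≤ _ at h4
  change ∑ s, X s ^ 2 = _ at h2
  change _ ≤ _ * ∑ s, X s ^ p
  have pt : ∀ s, X s ^ 2 ≤ (K * L) ^ (2 - p) * X s ^ p + X s ^ (4:ℝ) / (K * L) ^ 2 := by
    intro s
    have hKL : 0 < K * L := by positivity
    have n1 : 0 ≤ X s ^ p := Real.rpow_nonneg (hX0 s) _
    have n2 : 0 ≤ X s ^ (4:ℝ) := Real.rpow_nonneg (hX0 s) _
    by_cases hs : X s ≤ K * L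
    · have : X s ^ 2 = X s ^ (2 - p) * X s ^ p := by
        rcases (hX0 s).eq_or_lt with h0 | h0
        · rw [← h0, Real.zero_rpow hp.ne']; simp
        · rw [← Real.rpow_add h0]; simp
      rw [this]
      have : X s ^ (2 - p) ≤ (K * L) ^ (2 - p) := Real.rpow_le_rpow (hX0 s) hs (by linarith)
      have : 0 ≤ X s ^ (4:ℝ) / (K * L) ^ 2 := by positivity
      nlinarith
    · have hs' := le_of_not_ge hs
      have e4 : X s ^ (4:ℝ) = X s ^ 2 * X s ^ 2 := by
        rw [show (4:ℝ) = ((4:ℕ):ℝ) by norm_num, Real.rpow_natCast]; ring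
      have : X s ^ 2 ≤ X s ^ (4:ℝ) / (K * L) ^ 2 := by
        rw [le_div_iff₀ (by positivity), e4]
        gcongr
      have : 0 ≤ (K * L) ^ (2 - p) * X s ^ p := by positivity
      linarith
  have hsum := Finset.sum_le_sum fun s (_ : s ∈ Finset.univ) => pt s
  rw [h2, Finset.sum_add_distrib, ← Finset.mul_sum, ← Finset.sum_div] at hsum
  have hL4 : L ^ (4:ℝ) = L ^ 2 * L ^ 2 := by
    rw [show (4:ℝ) = ((4:ℕ):ℝ) by norm_num, Real.rpow_natCast]; ring
  have h5 : (∑ s, X s ^ (4:ℝ)) / (K * L) ^ 2 ≤ 2 ^ k * L ^ 2 / 2 := by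
    rw [div_le_iff₀ (by positivity), mul_pow, hKsq]
    rw [hL4] at h4
    calc _ ≤ _ := h4
      _ = _ := by ring
  have h6 : 2 ^ k * L ^ 2 ≤ 2 * ((K * L) ^ (2 - p) * ∑ s, X s ^ p) := by linarith
  rw [Real.mul_rpow hKpos.le hLpos.le] at h6
  have h7 : L ^ 2 = L ^ (2 - p) * L ^ p := by
    rw [← Real.rpow_add hLpos]; simp
  have h8 : 0 < L ^ (2 - p) := by positivity
  rw [h7] at h6
  have : L ^ (2 - p) * (2 ^ k * L ^ p) ≤ L ^ (2 - p) * (2 * K ^ (2 - p) * ∑ s, X s ^ p) := by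
    calc _ = 2 ^ k * (L ^ (2 - p) * L ^ p) := by ring
      _ ≤ _ := h6
      _ = _ := by ring
  exact le_of_mul_le_mul_left this h8

lemma three_lines_sum {R : Type*} [Fintype R] (c l : R → ℝ) (u v A0 A1 θ : ℝ)
    (h0 : ∀ y : ℝ, ‖∑ r, (c r : ℂ) * Complex.exp ((u + y * Complex.I) * l r)‖ ≤ A0)
    (h1 : ∀ y : ℝ, ‖∑ r, (c r : ℂ) * Complex.exp ((v + y * Complex.I) * l r)‖ ≤ A1)
    (hθ0 : 0 ≤ θ) (hθ1 : θ ≤ 1) :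
    ‖∑ r, (c r : ℂ) * Complex.exp (((1 - θ) * u + θ * v) * l r)‖ ≤ A0 ^ (1 - θ) * A1 ^ θ := by
  set f : ℂ → ℂ := fun z => ∑ r, (c r : ℂ) * Complex.exp (((1 - z) * u + z * v) * l r) with hf
  have hdiff : Differentiable ℂ f := by
    intro z
    simp only [hf]
    fun_prop
  have := Complex.HadamardThreeLines.norm_le_interp_of_mem_verticalClosedStrip₀₁' f
    (z := (θ : ℂ)) (a := A0) (b := A1) ?_ hdiff.diffContOnCl ?_ ?_ ?_
  · simpa [hf] using this
  · simp [Complex.HadamardThreeLines.verticalClosedStrip, hθ0, hθ1]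
  · refine ⟨∑ r, |c r| * Real.exp ((|u| + |v|) * |l r|), ?_⟩
    rintro _ ⟨z, hz, rfl⟩
    simp only [Complex.HadamardThreeLines.verticalClosedStrip, Set.mem_preimage, Set.mem_Icc] at hz
    simp only [Function.comp, hf]
    refine (norm_sum_le _ _).trans (Finset.sum_le_sum fun r _ => ?_)
    rw [norm_mul, Complex.norm_real, Complex.norm_exp]
    gcongr
    · exact le_refl _
    · have : (((1 - z) * u + z * v) * l r).re = ((1 - z.re) * u + z.re * v) * l r := by
        simp
      rw [this]
      refine (le_abs_self _).trans ?_
      rw [abs_mul]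
      gcongr
      refine (abs_add_le _ _).trans ?_
      rw [abs_mul, abs_mul, abs_of_nonneg hz.1, abs_of_nonneg (by linarith : 0 ≤ 1 - z.re)]
      have := abs_nonneg u
      have := abs_nonneg v
      nlinarith
  · intro z hz
    simp only [Set.mem_preimage, Set.mem_singleton_iff] at hz
    have hz' : z = (z.im : ℂ) * Complex.I := by
      apply Complex.ext <;> simp [hz]
    have e : (1 - z) * u + z * v = u + ((z.im * (v - u) : ℝ) : ℂ) * Complex.I := by
      conv_lhs => rw [hz']
      push_cast; ring
    simp only [hf]
    rw [e]
    exact h0 _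
  · intro z hz
    simp only [Set.mem_preimage, Set.mem_singleton_iff] at hz
    have hz' : z = 1 + (z.im : ℂ) * Complex.I := by
      apply Complex.ext <;> simp [hz]
    have e : (1 - z) * u + z * v = v + ((z.im * (v - u) : ℝ) : ℂ) * Complex.I := by
      conv_lhs => rw [hz']
      push_cast; ring
    simp only [hf]
    rw [e]
    exact h1 _

/-- `exp ((e + i y) log f)` has modulus `f ^ e` when `f > 0` -/
lemma norm_exp_log (e y f : ℝ) (hf : 0 < f) :
    ‖Complex.exp ((e + y * Complex.I) * (Real.log f : ℝ))‖ = f ^ e := by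
  rw [Complex.norm_exp, Real.rpow_def_of_pos hf]
  simp [mul_comm]

lemma sum_sq_twist {k : ℕ} (w : Fin k → ℝ) (f p y : ℝ) (hp : 0 < p) (hf0 : 0 ≤ f)
    (hf : ∑ i, w i ^ 2 = f ^ 2) :
    ∑ i, ‖(w i : ℂ) * Complex.exp (((p / 2 - 1 : ℝ) + y * Complex.I) * (Real.log f : ℝ))‖ ^ 2
      = f ^ p := by
  rcases hf0.eq_or_lt with h | h
  · have h0 : ∀ i, w i = 0 := by
      intro i
      rw [← h] at hf
      have := (Finset.sum_eq_zero_iff_of_nonneg (fun i _ => sq_nonneg (w i))).1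
        (by simpa using hf) i (Finset.mem_univ i)
      simpa using this
    simp [h0, ← h, Real.zero_rpow hp.ne']
  · simp_rw [norm_mul, norm_exp_log _ _ _ h, mul_pow]
    rw [← Finset.sum_mul]
    simp only [Complex.norm_real, Real.norm_eq_abs, sq_abs]
    rw [hf, ← Real.rpow_natCast, ← Real.rpow_natCast, ← Real.rpow_mul h.le, ← Real.rpow_add h]
    congr 1
    push_cast; ring

set_option maxHeartbeats 2000000 in
/-- Vector valued Hausdorff-Young inequality for Walsh matrices. -/
lemma hy_block {k m : ℕ} (p p' : ℝ) (hp1 : 1 < p) (hp2 : p < 2) (hc : p.HolderConjugate p')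
    (x : Fin k → Finset (Fin m) → ℝ)
    (hx : ∀ a : Fin k → ℝ, ∑ i, a i ^ 2 ≤ 1 → ∑ t, |∑ i, a i * x i t| ^ p ≤ 1) :
    ∑ s, (∑ i, (∑ t, wal s t * x i t) ^ 2) ^ (p' / 2)
      ≤ 2 ^ m * (∑ t, (∑ i, x i t ^ 2) ^ (p / 2)) ^ (2 / p) := by
  have hp0 : 0 < p := by linarith
  have hp'0 : 0 < p' := hc.symm.pos
  have hinv : p⁻¹ + p'⁻¹ = 1 := hc.inv_add_inv_eq_one
  have hp'2 : 2 < p' := by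
    have h1 : (1:ℝ)/2 < p⁻¹ := by rw [← one_div]; exact one_div_lt_one_div_of_lt hp0 hp2
    have h2 : p'⁻¹ < 1/2 := by linarith
    rw [inv_eq_one_div] at h2
    exact (one_div_lt_one_div hp'0 (by norm_num)).1 h2
  have hpp : p + p' = p * p' := by
    field_simp at hinv; linarith
  set f : Finset (Fin m) → ℝ := fun t => Real.sqrt (∑ i, x i t ^ 2) with hf
  have hf0 : ∀ t, 0 ≤ f t := fun t => Real.sqrt_nonneg _
  have hfs : ∀ t, ∑ i, x i t ^ 2 = f t ^ 2 :=
    fun t => (Real.sq_sqrt (Finset.sum_nonneg fun i _ => sq_nonneg _)).symm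
  set y : Fin k → Finset (Fin m) → ℝ := fun i s => ∑ t, wal s t * x i t with hy
  set g : Finset (Fin m) → ℝ := fun s => Real.sqrt (∑ i, y i s ^ 2) with hg
  have hg0 : ∀ t, 0 ≤ g t := fun t => Real.sqrt_nonneg _
  have hgs : ∀ s, ∑ i, y i s ^ 2 = g s ^ 2 :=
    fun s => (Real.sq_sqrt (Finset.sum_nonneg fun i _ => sq_nonneg _)).symm
  have sqr : ∀ (a e : ℝ), 0 ≤ a → (a ^ 2) ^ (e / 2) = a ^ e := by
    intro a e ha
    rw [← Real.rpow_natCast, ← Real.rpow_mul ha]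
    congr 1; push_cast; ring
  change ∑ s, (∑ i, y i s ^ 2) ^ (p' / 2) ≤ _
  simp_rw [hfs, hgs, sqr _ _ (hf0 _), sqr _ _ (hg0 _)]
  set A := ∑ s, g s ^ p' with hA
  set M := ∑ t, f t ^ p with hM
  have hM0 : 0 ≤ M := Finset.sum_nonneg fun t _ => Real.rpow_nonneg (hf0 t) _
  have hA0 : 0 ≤ A := Finset.sum_nonneg fun t _ => Real.rpow_nonneg (hg0 t) _
  rcases hA0.eq_or_lt with hAz | hApos
  · rw [← hAz]; positivity
  -- the dual element
  set b : Fin k → Finset (Fin m) → ℝ := fun i s => y i s * g s ^ (p' - 2) with hb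
  set h : Finset (Fin m) → ℝ := fun s => g s ^ (p' - 1) with hh
  have hh0 : ∀ s, 0 ≤ h s := fun s => Real.rpow_nonneg (hg0 s) _
  have hbs : ∀ s, ∑ i, b i s ^ 2 = h s ^ 2 := by
    intro s
    simp only [hb, hh, mul_pow]
    rw [← Finset.sum_mul, hgs]
    rcases (hg0 s).eq_or_lt with h' | h'
    · rw [← h', Real.zero_rpow (by linarith), Real.zero_rpow (by linarith)]; simp
    · rw [← mul_pow]
      congr 1
      nth_rw 1 [← Real.rpow_one (g s)]
      rw [← Real.rpow_add h']; congr 1; ring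
  have hhp : ∀ s, h s ^ p = g s ^ p' := by
    intro s
    simp only [hh]
    rw [← Real.rpow_mul (hg0 s)]
    congr 1; linarith
  have hyb : ∀ s, ∑ i, y i s * b i s = g s ^ p' := by
    intro s
    simp only [hb]
    have : ∀ i, y i s * (y i s * g s ^ (p' - 2)) = y i s ^ 2 * g s ^ (p' - 2) := by intro i; ring
    simp_rw [this]
    rw [← Finset.sum_mul, hgs]
    rcases (hg0 s).eq_or_lt with h' | h'
    · rw [← h', Real.zero_rpow (by linarith), Real.zero_rpow (by linarith)]; simp
    · rw [← Real.rpow_natCast, ← Real.rpow_add h']; congr 1; push_cast; ring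
  set c : Finset (Fin m) × Finset (Fin m) → ℝ :=
    fun r => wal r.1 r.2 * ∑ i, x i r.2 * b i r.1 with hcdef
  set l : Finset (Fin m) × Finset (Fin m) → ℝ :=
    fun r => Real.log (f r.2) + Real.log (h r.1) with hl
  set θ := 2 / p' with hθ
  have hθ0 : 0 ≤ θ := by positivity
  have hθ1 : θ ≤ 1 := by rw [hθ, div_le_one hp'0]; exact hp'2.le
  have three := three_lines_sum c l (p - 1) (p / 2 - 1) (A * M ^ (1 / p'))
    ((2 ^ m * M) ^ (1 / 2 : ℝ) * A ^ (1 / 2 : ℝ)) θ ?_ ?_ hθ0 hθ1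
  · have hz : ((1 - θ) * (p - 1) + θ * (p / 2 - 1) : ℂ) = 0 := by
      have : ((1 - θ) * (p - 1) + θ * (p / 2 - 1) : ℝ) = 0 := by
        rw [hθ]; field_simp; linear_combination -hpp
      exact_mod_cast this
    have hz2 : ((1 - (θ:ℂ)) * ((p - 1 : ℝ) : ℂ) + (θ:ℂ) * ((p / 2 - 1 : ℝ) : ℂ)) = 0 := by
      rw [← hz]; push_cast; ring
    rw [hz2] at three
    have hsumc : ∑ r, c r = A := by
      rw [Fintype.sum_prod_type, hA]
      refine Finset.sum_congr rfl fun s _ => ?_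
      rw [← hyb s]
      simp only [hcdef, hy, Finset.mul_sum, Finset.sum_mul]
      rw [Finset.sum_comm]
      refine Finset.sum_congr rfl fun i _ => Finset.sum_congr rfl fun t _ => ?_
      ring
    simp only [zero_mul, Complex.exp_zero, mul_one] at three
    rw [← Complex.ofReal_sum, hsumc, Complex.norm_real, Real.norm_of_nonneg hA0] at three
    have hR : (A * M ^ (1 / p')) ^ (1 - θ) * ((2 ^ m * M) ^ (1 / 2 : ℝ) * A ^ (1 / 2 : ℝ)) ^ θ
        = A ^ (1 - 1 / p') * ((2 ^ m) ^ (1 / p') * M ^ (2 / p * (1 / p'))) := by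
      have e1 : (A * M ^ (1 / p')) ^ (1 - θ) = A ^ (1 - θ) * M ^ ((1 / p') * (1 - θ)) := by
        rw [Real.mul_rpow hA0 (by positivity), ← Real.rpow_mul hM0]
      have e2 : ((2 ^ m * M) ^ (1 / 2 : ℝ) * A ^ (1 / 2 : ℝ)) ^ θ
          = (2 ^ m) ^ (1 / p') * M ^ (1 / p') * A ^ (1 / p') := by
        rw [Real.mul_rpow (by positivity) (by positivity), ← Real.rpow_mul (by positivity),
          ← Real.rpow_mul (by positivity), Real.mul_rpow (by positivity) hM0]
        have : 1 / 2 * θ = 1 / p' := by rw [hθ]; field_simp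
        rw [this]
      rw [e1, e2]
      have e3 : A ^ (1 - 1 / p') = A ^ (1 - θ) * A ^ (1 / p') := by
        rw [← Real.rpow_add hApos]; congr 1; rw [hθ]; ring
      have e4 : M ^ (2 / p * (1 / p')) = M ^ ((1 / p') * (1 - θ)) * M ^ (1 / p') := by
        rw [← Real.rpow_add_of_nonneg hM0 (by have : 0 ≤ 1 - θ := by linarith
                                              positivity) (by positivity)]
        congr 1; rw [hθ]; field_simp; linear_combination 2 * hpp
      rw [e3, e4]; ring
    rw [hR] at three
    have hsplit : A = A ^ (1 - 1 / p') * A ^ (1 / p') := by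
      rw [← Real.rpow_add hApos]; simp
    have h5 : A ^ (1 / p') ≤ (2 ^ m) ^ (1 / p') * M ^ (2 / p * (1 / p')) := by
      have hpos : 0 < A ^ (1 - 1 / p') := by positivity
      refine le_of_mul_le_mul_left ?_ hpos
      rw [← hsplit]; exact three
    have h6 : (2 ^ m : ℝ) ^ (1 / p') * M ^ (2 / p * (1 / p')) = (2 ^ m * M ^ (2 / p)) ^ (1 / p') := by
      rw [Real.mul_rpow (by positivity) (by positivity), ← Real.rpow_mul hM0]
    rw [h6] at h5
    exact (Real.rpow_le_rpow_iff hA0 (by positivity) (by positivity)).1 h5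
  · -- first edge
    intro Y
    rw [Fintype.sum_prod_type, hA, Finset.sum_mul]
    refine (norm_sum_le _ _).trans (Finset.sum_le_sum fun s _ => ?_)
    rcases (hh0 s).eq_or_lt with hs | hs
    · have hb0 : ∀ i, b i s = 0 := by
        intro i
        have h1 := hbs s
        rw [← hs] at h1
        have := (Finset.sum_eq_zero_iff_of_nonneg (fun i _ => sq_nonneg (b i s))).1
          (by simpa using h1) i (Finset.mem_univ i)
        simpa using this
      simp only [hcdef, hb0]
      simp only [mul_zero, Finset.sum_const_zero, Complex.ofReal_zero, zero_mul, norm_zero]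
      exact mul_nonneg (Real.rpow_nonneg (hg0 s) _) (Real.rpow_nonneg hM0 _)
    rw [← hhp s]
    set a : Fin k → ℝ := fun i => b i s / h s with ha
    have ha1 : ∑ i, a i ^ 2 ≤ 1 := by
      simp only [ha, div_pow]
      rw [← Finset.sum_div, hbs, div_self (pow_ne_zero 2 hs.ne')]
    have hxa := hx a ha1
    have hcs : ∀ t, ‖((c (s, t) : ℝ) : ℂ) * Complex.exp (((p - 1 : ℝ) + Y * Complex.I) * (l (s, t) : ℝ))‖
        = h s ^ p * (|∑ i, a i * x i t| * f t ^ (p - 1)) := by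
      intro t
      have hca : c (s, t) = wal s t * (h s * ∑ i, a i * x i t) := by
        simp only [hcdef, ha]
        congr 1
        rw [Finset.mul_sum]
        refine Finset.sum_congr rfl fun i _ => ?_
        field_simp
      rcases (hf0 t).eq_or_lt with ht | ht
      · have hx0 : ∀ i, x i t = 0 := by
          intro i
          have h1 := hfs t
          rw [← ht] at h1
          have := (Finset.sum_eq_zero_iff_of_nonneg (fun i _ => sq_nonneg (x i t))).1
            (by simpa using h1) i (Finset.mem_univ i)
          simpa using this
        rw [hca]
        simp [hx0]
      · rw [hca, norm_mul]
        simp only [hl]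
        push_cast
        rw [mul_add, Complex.exp_add, norm_mul (Complex.exp _) (Complex.exp _)]
        have q1 := norm_exp_log (p - 1) Y (f t) ht
        have q2 := norm_exp_log (p - 1) Y (h s) hs
        push_cast at q1 q2
        rw [q1, q2]
        have : ‖(wal s t : ℂ) * (h s * ∑ i, (a i : ℂ) * (x i t : ℂ))‖ = h s * |∑ i, a i * x i t| := by
          have : (wal s t : ℂ) * (h s * ∑ i, (a i : ℂ) * (x i t : ℂ))
            = ((wal s t * (h s * ∑ i, a i * x i t) : ℝ) : ℂ) := by push_cast; ring
          rw [this, Complex.norm_real, Real.norm_eq_abs, abs_mul, abs_mul, abs_wal, abs_of_pos hs, one_mul]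
        rw [this]
        have : h s ^ p = h s * h s ^ (p - 1) := by
          nth_rw 2 [← Real.rpow_one (h s)]
          rw [← Real.rpow_add hs]; congr 1; ring
        rw [this]; ring
    refine (norm_sum_le _ _).trans ?_
    have hcs' : ∀ t, ‖((c (s, t) : ℝ) : ℂ) * Complex.exp (((p : ℂ) - 1 + Y * Complex.I) * (l (s, t) : ℝ))‖
        = h s ^ p * (|∑ i, a i * x i t| * f t ^ (p - 1)) := by
      intro t; rw [← hcs t]; push_cast; rfl
    have hcs'' : ∀ t, ‖((c (s, t) : ℝ) : ℂ) * Complex.exp ((((p - 1 : ℝ) : ℂ) + Y * Complex.I) * (l (s, t) : ℝ))‖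
        = h s ^ p * (|∑ i, a i * x i t| * f t ^ (p - 1)) := hcs
    simp only [hcs'']
    rw [← Finset.mul_sum]
    have hold := Real.inner_le_Lp_mul_Lq_of_nonneg Finset.univ hc
      (f := fun t => |∑ i, a i * x i t|) (g := fun t => f t ^ (p - 1))
      (fun _ _ => abs_nonneg _) (fun t _ => Real.rpow_nonneg (hf0 t) _)
    have hfp : ∀ t, (f t ^ (p - 1)) ^ p' = f t ^ p := by
      intro t
      rw [← Real.rpow_mul (hf0 t)]; congr 1; linarith
    simp only [hfp] at hold
    have : (∑ t, |∑ i, a i * x i t| ^ p) ^ (1 / p) ≤ 1 :=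
      Real.rpow_le_one (Finset.sum_nonneg fun t _ => by positivity) hxa (by positivity)
    have hMp : 0 ≤ M ^ (1 / p') := Real.rpow_nonneg hM0 _
    have : ∑ t, |∑ i, a i * x i t| * f t ^ (p - 1) ≤ M ^ (1 / p') := hold.trans (by nlinarith)
    have hsp : 0 ≤ h s ^ p := Real.rpow_nonneg (hh0 s) _
    exact mul_le_mul_of_nonneg_left this hsp
  · -- second edge
    intro Y
    set X : Fin k → Finset (Fin m) → ℂ := fun i t =>
      (x i t : ℂ) * Complex.exp (((p / 2 - 1 : ℝ) + Y * Complex.I) * (Real.log (f t) : ℝ)) with hX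
    set B : Fin k → Finset (Fin m) → ℂ := fun i s =>
      (b i s : ℂ) * Complex.exp (((p / 2 - 1 : ℝ) + Y * Complex.I) * (Real.log (h s) : ℝ)) with hB
    have hXs : ∀ t, ∑ i, ‖X i t‖ ^ 2 = f t ^ p := fun t =>
      sum_sq_twist (fun i => x i t) (f t) p Y hp0 (hf0 t) (hfs t)
    have hBs : ∀ s, ∑ i, ‖B i s‖ ^ 2 = g s ^ p' := fun s => by
      rw [← hhp]
      exact sum_sq_twist (fun i => b i s) (h s) p Y hp0 (hh0 s) (hbs s)
    have hrew : ∑ r, (c r : ℂ) * Complex.exp ((((p / 2 - 1 : ℝ) : ℂ) + Y * Complex.I) * (l r : ℝ))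
        = ∑ r : Finset (Fin m) × Fin k, (∑ t, (wal r.1 t : ℂ) * X r.2 t) * B r.2 r.1 := by
      rw [Fintype.sum_prod_type, Fintype.sum_prod_type]
      refine Finset.sum_congr rfl fun s _ => ?_
      simp only [hcdef, hl, hX, hB]
      simp only [Finset.sum_mul]
      rw [Finset.sum_comm]
      refine Finset.sum_congr rfl fun t _ => ?_
      push_cast
      rw [mul_add, Complex.exp_add, Finset.mul_sum, Finset.sum_mul]
      refine Finset.sum_congr rfl fun i _ => ?_
      ring
    rw [hrew]
    have cs := Real.inner_le_Lp_mul_Lq_of_nonneg (Finset.univ : Finset (Finset (Fin m) × Fin k))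
      (p := 2) (q := 2) (by constructor <;> norm_num)
      (f := fun r => ‖∑ t, (wal r.1 t : ℂ) * X r.2 t‖) (g := fun r => ‖B r.2 r.1‖)
      (fun _ _ => norm_nonneg _) (fun _ _ => norm_nonneg _)
    refine (norm_sum_le _ _).trans ?_
    simp only [norm_mul]
    refine cs.trans (le_of_eq ?_)
    congr 2
    · rw [Fintype.sum_prod_type, Finset.sum_comm]
      have : ∀ i, ∑ s : Finset (Fin m), ‖∑ t, (wal s t : ℂ) * X i t‖ ^ (2:ℝ) = 2 ^ m * ∑ t, ‖X i t‖ ^ 2 := by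
        intro i
        rw [← wal_parseval (𝕜 := ℂ)]
        simp
      simp only [this]
      rw [← Finset.mul_sum, Finset.sum_comm, hM]
      simp only [hXs]
    · rw [Fintype.sum_prod_type, hA]
      refine Finset.sum_congr rfl fun s _ => ?_
      rw [← hBs]
      simp

/-- The vector valued Walsh block estimate, averaged over signs. -/
lemma block_rad (𝕜 : Type*) [RCLike 𝕜] (p p' : ℝ) (hp1 : 1 < p) (hp2 : p < 2)
    (hc : p.HolderConjugate p') :
    ∃ C : ℝ, 0 < C ∧ ∀ (m k : ℕ) (x : Fin k → Finset (Fin m) → 𝕜),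
      (∀ a : Fin k → ℝ, ∑ i, a i ^ 2 ≤ 1 → ∑ t, ‖∑ i, (a i : 𝕜) * x i t‖ ^ p ≤ 1) →
      ∑ e : Finset (Fin k), ∑ s, ‖∑ t, (wal s t : 𝕜) * ∑ i, (rad i e : 𝕜) * x i t‖ ^ p'
        ≤ C * 2 ^ k * (2 ^ m * (∑ t, (∑ i, ‖x i t‖ ^ 2) ^ (p / 2)) ^ (2 / p)) := by
  have hp'0 : 0 < p' := hc.symm.pos
  have hp0 : 0 < p := hc.pos
  obtain ⟨C, hC, h⟩ := khinchin_upper_real p' hp'0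
  refine ⟨2 ^ p' * (C + C), by positivity, fun m k x hx => ?_⟩
  set D : ℝ := 2 ^ m * (∑ t, (∑ i, ‖x i t‖ ^ 2) ^ (p / 2)) ^ (2 / p) with hD
  -- generic real part
  have part : ∀ (φ : 𝕜 →ₗ[ℝ] ℝ), (∀ z, |φ z| ≤ ‖z‖) →
      ∑ e : Finset (Fin k), ∑ s, |∑ i, rad i e * ∑ t, wal s t * φ (x i t)| ^ p' ≤ C * 2 ^ k * D := by
    intro φ hφ
    rw [Finset.sum_comm]
    have h1 : ∑ s, (∑ i, (∑ t, wal s t * φ (x i t)) ^ 2) ^ (p' / 2)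
        ≤ 2 ^ m * (∑ t, (∑ i, φ (x i t) ^ 2) ^ (p / 2)) ^ (2 / p) := by
      refine hy_block p p' hp1 hp2 hc _ fun a ha => ?_
      refine le_trans (Finset.sum_le_sum fun t _ => ?_) (hx a ha)
      refine Real.rpow_le_rpow (abs_nonneg _) ?_ hp0.le
      refine le_trans (le_of_eq ?_) (hφ _)
      congr 1
      rw [map_sum]
      refine Finset.sum_congr rfl fun i _ => ?_
      rw [← RCLike.real_smul_eq_coe_mul, map_smul, smul_eq_mul]
    have h2 : 2 ^ m * (∑ t, (∑ i, φ (x i t) ^ 2) ^ (p / 2)) ^ (2 / p) ≤ D := by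
      rw [hD]
      have e : ∀ t i, φ (x i t) ^ 2 ≤ ‖x i t‖ ^ 2 := fun t i => by
        rw [← sq_abs]
        exact pow_le_pow_left₀ (abs_nonneg _) (hφ _) 2
      refine mul_le_mul_of_nonneg_left (Real.rpow_le_rpow ?_ ?_ (by positivity)) (by positivity)
      · exact Finset.sum_nonneg fun t _ => Real.rpow_nonneg (Finset.sum_nonneg fun i _ => sq_nonneg _) _
      · exact Finset.sum_le_sum fun t _ => Real.rpow_le_rpow
          (Finset.sum_nonneg fun i _ => sq_nonneg _) (Finset.sum_le_sum fun i _ => e t i) (by positivity)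
    calc _ ≤ ∑ s, C * 2 ^ k * (∑ i, (∑ t, wal s t * φ (x i t)) ^ 2) ^ (p' / 2) :=
          Finset.sum_le_sum fun s _ => h k _
      _ = C * 2 ^ k * ∑ s, (∑ i, (∑ t, wal s t * φ (x i t)) ^ 2) ^ (p' / 2) := by
          rw [Finset.mul_sum]
      _ ≤ _ := by
          have := h1.trans h2
          gcongr
  have hre := part RCLike.reLm (fun z => by simpa using RCLike.abs_re_le_norm z)
  have him := part RCLike.imLm (fun z => by simpa using RCLike.abs_im_le_norm z)
  have swap : ∀ (e : Finset (Fin k)) (s : Finset (Fin m)),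
      ∑ t, (wal s t : 𝕜) * ∑ i, (rad i e : 𝕜) * x i t
        = ∑ i, (rad i e : 𝕜) * ∑ t, (wal s t : 𝕜) * x i t := by
    intro e s
    simp only [Finset.mul_sum]
    rw [Finset.sum_comm]
    exact Finset.sum_congr rfl fun i _ => Finset.sum_congr rfl fun t _ => by ring
  simp only [swap]
  calc _ ≤ ∑ e : Finset (Fin k), ∑ s : Finset (Fin m),
        2 ^ p' * (|∑ i, rad i e * ∑ t, wal s t * RCLike.reLm (x i t)| ^ p'
          + |∑ i, rad i e * ∑ t, wal s t * RCLike.imLm (x i t)| ^ p') := by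
        refine Finset.sum_le_sum fun e _ => Finset.sum_le_sum fun s _ => ?_
        refine (rclike_norm_rpow_le p' hp'0 _).trans (le_of_eq ?_)
        simp only [re_sum_real_mul, im_sum_real_mul]
        rfl
    _ ≤ 2 ^ p' * (C * 2 ^ k * D + C * 2 ^ k * D) := by
        simp only [← Finset.mul_sum, Finset.sum_add_distrib]
        gcongr
    _ = _ := by ring

/-- `ℓ_p → ℓ_{p'}` bound for a single Walsh block. -/
lemma block_bound (𝕜 : Type*) [RCLike 𝕜] (p p' : ℝ) (hp1 : 1 < p) (hp2 : p < 2)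
    (hc : p.HolderConjugate p') :
    ∃ C : ℝ, 0 < C ∧ ∀ (m : ℕ) (x : Finset (Fin m) → 𝕜),
      ∑ s, ‖∑ t, (wal s t : 𝕜) * x t‖ ^ p' ≤ C * (2 ^ m * (∑ t, ‖x t‖ ^ p) ^ (p' / p)) := by
  have hp'0 : 0 < p' := hc.symm.pos
  have hp0 : 0 < p := hc.pos
  obtain ⟨C, hC, h⟩ := block_rad 𝕜 p p' hp1 hp2 hc
  refine ⟨C, hC, fun m x => ?_⟩
  set N := ∑ t, ‖x t‖ ^ p with hN
  have hN0 : 0 ≤ N := Finset.sum_nonneg fun t _ => by positivity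
  rcases hN0.eq_or_lt with hz | hpos
  · have : ∀ t, x t = 0 := by
      intro t
      have := (Finset.sum_eq_zero_iff_of_nonneg (fun t _ => by positivity)).1 (hN.symm.trans hz.symm) t
        (Finset.mem_univ t)
      rw [Real.rpow_eq_zero (norm_nonneg _) hp0.ne'] at this
      simpa using this
    simp only [this, mul_zero, Finset.sum_const_zero, norm_zero, Real.zero_rpow hp'0.ne']
    positivity
  set r : ℝ := N ^ (1 / p) with hr
  have hrpos : 0 < r := by positivity
  have hrp : r ^ p = N := by rw [hr, ← Real.rpow_mul hN0]; field_simp; simp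
  have hrp' : r ^ p' = N ^ (p' / p) := by rw [hr, ← Real.rpow_mul hN0]; congr 1; ring
  have key := h m 1 (fun _ t => ((r⁻¹ : ℝ) : 𝕜) * x t) ?_
  · simp only [Fin.sum_univ_one] at key
    have hx1 : ∑ t, (‖((r⁻¹ : ℝ) : 𝕜) * x t‖ ^ 2) ^ (p / 2) = 1 := by
      have : ∀ t, (‖((r⁻¹ : ℝ) : 𝕜) * x t‖ ^ 2) ^ (p / 2) = (r ^ p)⁻¹ * ‖x t‖ ^ p := by
        intro t
        rw [← Real.rpow_natCast, ← Real.rpow_mul (norm_nonneg _), norm_mul, RCLike.norm_ofReal,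
          abs_of_pos (by positivity), Real.mul_rpow (by positivity) (norm_nonneg _),
          Real.inv_rpow hrpos.le]
        have : ((2:ℕ):ℝ) * (p / 2) = p := by push_cast; ring
        rw [this]
      simp only [this]
      rw [← Finset.mul_sum, ← hN, hrp]; field_simp
    rw [hx1, Real.one_rpow] at key
    have hterm : ∀ (e : Finset (Fin 1)) (s : Finset (Fin m)),
        ‖∑ t, (wal s t : 𝕜) * ((rad 0 e : 𝕜) * (((r⁻¹ : ℝ) : 𝕜) * x t))‖ ^ p'
          = (r ^ p')⁻¹ * ‖∑ t, (wal s t : 𝕜) * x t‖ ^ p' := by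
      intro e s
      have : ∑ t, (wal s t : 𝕜) * ((rad 0 e : 𝕜) * (((r⁻¹ : ℝ) : 𝕜) * x t))
          = (rad 0 e : 𝕜) * (((r⁻¹ : ℝ) : 𝕜) * ∑ t, (wal s t : 𝕜) * x t) := by
        simp only [Finset.mul_sum]
        exact Finset.sum_congr rfl fun t _ => by ring
      rw [this, norm_mul, norm_mul, RCLike.norm_ofReal, RCLike.norm_ofReal, abs_rad, one_mul,
          abs_of_pos (by positivity), Real.mul_rpow (by positivity) (norm_nonneg _),
          Real.inv_rpow hrpos.le]
    simp only [hterm] at key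
    rw [Finset.sum_const, ← Finset.mul_sum, Finset.card_univ, Fintype.card_finset, Fintype.card_fin,
      nsmul_eq_mul] at key
    rw [← hrp']
    have hq : 0 < r ^ p' := by positivity
    rw [inv_mul_eq_div, ← mul_div_assoc, div_le_iff₀ hq] at key
    push_cast at key
    linarith
  · intro a ha
    have : ∀ t, ‖∑ i, (a i : 𝕜) * (((r⁻¹ : ℝ) : 𝕜) * x t)‖ ^ p = |a 0| ^ p * ((r ^ p)⁻¹ * ‖x t‖ ^ p) := by
      intro t
      rw [Fin.sum_univ_one, norm_mul, norm_mul, RCLike.norm_ofReal, RCLike.norm_ofReal,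
        Real.mul_rpow (by positivity) (by positivity), abs_of_pos (by positivity : 0 < r⁻¹),
        Real.mul_rpow (by positivity) (norm_nonneg _), Real.inv_rpow hrpos.le]
    simp only [this]
    rw [← Finset.mul_sum, ← Finset.mul_sum, ← hN, hrp, inv_mul_cancel₀ hpos.ne', mul_one]
    refine Real.rpow_le_one (abs_nonneg _) ?_ hp0.le
    rw [Fin.sum_univ_one] at ha
    exact abs_le_one_iff_mul_self_le_one.2 (by nlinarith)

lemma lp_mk {𝕜 E β : Type*} [RCLike 𝕜] [NormedAddCommGroup E] [NormedSpace 𝕜 E]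
    (R : ℝ≥0∞) [Fact (1 ≤ R)] (r : ℝ) (hR : R.toReal = r) (hr : 0 < r)
    (L : E →ₗ[𝕜] (β → 𝕜)) (C : ℝ) (hC : 0 ≤ C)
    (h : ∀ x (s : Finset β), ∑ b ∈ s, ‖L x b‖ ^ r ≤ (C * ‖x‖) ^ r) :
    ∃ T : E →L[𝕜] lp (fun _ : β => 𝕜) R, ∀ x b, T x b = L x b := by
  subst hR
  let T0 : E →ₗ[𝕜] lp (fun _ : β => 𝕜) R :=
    { toFun := fun x => ⟨L x, memℓp_gen' (h x)⟩
      map_add' := fun x y => by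
        ext b; simp; rfl
      map_smul' := fun c x => by
        ext b; simp }
  refine ⟨T0.mkContinuous C fun x => ?_, fun x b => rfl⟩
  exact lp.norm_le_of_forall_sum_le hr (by positivity) (h x)

lemma rpow_le_aux (M N e : ℝ) (hM : 0 ≤ M) (hMN : M ≤ N) (he : 1 ≤ e) :
    M ^ e ≤ N ^ (e - 1) * M := by
  rcases hM.eq_or_lt with h | h
  · rw [← h, Real.zero_rpow (by linarith)]; simp
  · calc M ^ e = M ^ (e - 1) * M := by
          nth_rw 3 [← Real.rpow_one M]
          rw [← Real.rpow_add h]; congr 1; ring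
      _ ≤ _ := by
          gcongr

lemma exists_blockOp {𝕜 : Type*} [RCLike 𝕜] (P R : ℝ≥0∞) [Fact (1 ≤ P)] [Fact (1 ≤ R)]
    (p r : ℝ) (hP : P.toReal = p) (hR : R.toReal = r) (hp : 0 < p) (hpr : p ≤ r)
    {A B : ℕ → Type} [∀ k, Fintype (A k)] [∀ k, Fintype (B k)]
    (L : ∀ k, (A k → 𝕜) →ₗ[𝕜] (B k → 𝕜)) (C : ℝ) (hC : 0 ≤ C)
    (hL : ∀ k x, ∑ b, ‖L k x b‖ ^ r ≤ C * (∑ a, ‖x a‖ ^ p) ^ (r / p)) :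
    ∃ T : lp (fun _ : (Σ k, A k) => 𝕜) P →L[𝕜] lp (fun _ : (Σ k, B k) => 𝕜) R,
      ∀ x k b, T x ⟨k, b⟩ = L k (fun a => x ⟨k, a⟩) b := by
  classical
  have hr : 0 < r := hp.trans_le hpr
  have he : 1 ≤ r / p := by rwa [le_div_iff₀ hp, one_mul]
  let L0 : lp (fun _ : (Σ k, A k) => 𝕜) P →ₗ[𝕜] ((Σ k, B k) → 𝕜) :=
    { toFun := fun x b => L b.1 (fun a => x ⟨b.1, a⟩) b.2
      map_add' := fun x y => by
        ext b
        have : (fun a => (x + y) ⟨b.1, a⟩) = (fun a => x ⟨b.1, a⟩) + fun a => y ⟨b.1, a⟩ := rfl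
        rw [this, map_add]; rfl
      map_smul' := fun c x => by
        ext b
        have : (fun a => (c • x) ⟨b.1, a⟩) = c • (fun a => x ⟨b.1, a⟩) := rfl
        rw [this, map_smul]; rfl }
  suffices h : ∀ x (s : Finset (Σ k, B k)), ∑ b ∈ s, ‖L0 x b‖ ^ r ≤ (C ^ (1 / r) * ‖x‖) ^ r by
    obtain ⟨T, hT⟩ := lp_mk R r hR hr L0 (C ^ (1 / r)) (by positivity) h
    exact ⟨T, fun x k b => hT x ⟨k, b⟩⟩
  intro x s
  set N := ‖x‖ ^ p with hN
  have hN0 : 0 ≤ N := by positivity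
  set M : ℕ → ℝ := fun k => ∑ a, ‖x ⟨k, a⟩‖ ^ p with hM
  have hM0 : ∀ k, 0 ≤ M k := fun k => Finset.sum_nonneg fun a _ => by positivity
  have hMs : ∀ K : Finset ℕ, ∑ k ∈ K, M k ≤ N := by
    intro K
    have := lp.sum_rpow_le_norm_rpow (by rw [hP]; exact hp) x (K.sigma fun k => Finset.univ)
    rw [Finset.sum_sigma, hP] at this
    exact this
  have hM1 : ∀ k, M k ≤ N := fun k => by simpa using hMs {k}
  calc ∑ b ∈ s, ‖L0 x b‖ ^ r
      ≤ ∑ b ∈ (s.image Sigma.fst).sigma (fun k => Finset.univ), ‖L0 x b‖ ^ r := by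
        refine Finset.sum_le_sum_of_subset_of_nonneg ?_ fun _ _ _ => by positivity
        intro b hb
        simp only [Finset.mem_sigma, Finset.mem_image, Finset.mem_univ, and_true]
        exact ⟨b, hb, rfl⟩
    _ = ∑ k ∈ s.image Sigma.fst, ∑ b, ‖L k (fun a => x ⟨k, a⟩) b‖ ^ r := by
        rw [Finset.sum_sigma]; rfl
    _ ≤ ∑ k ∈ s.image Sigma.fst, C * (N ^ (r / p - 1) * M k) := by
        refine Finset.sum_le_sum fun k _ => (hL k _).trans ?_
        exact mul_le_mul_of_nonneg_left (rpow_le_aux _ _ _ (hM0 k) (hM1 k) he) hC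
    _ ≤ C * (N ^ (r / p - 1) * N) := by
        rw [← Finset.mul_sum, ← Finset.mul_sum]
        have := hMs (s.image Sigma.fst)
        gcongr
    _ = C * N ^ (r / p) := by
        congr 1
        nth_rw 2 [← Real.rpow_one N]
        rw [← Real.rpow_add_of_nonneg hN0 (by linarith) (by norm_num)]
        congr 1; ring
    _ = (C ^ (1 / r) * ‖x‖) ^ r := by
        rw [Real.mul_rpow (by positivity) (norm_nonneg _), ← Real.rpow_mul hC, hN,
          ← Real.rpow_mul (norm_nonneg _)]
        field_simp
        simp [mul_comm]

lemma exists_reindex {𝕜 : Type*} [RCLike 𝕜] (P R : ℝ≥0∞) [Fact (1 ≤ P)] [Fact (1 ≤ R)]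
    (p r : ℝ) (hP : P.toReal = p) (hR : R.toReal = r) (hp : 0 < p) (hpr : p ≤ r)
    {α β : Type*} (e : α ≃ β) :
    ∃ T : lp (fun _ : β => 𝕜) P →L[𝕜] lp (fun _ : α => 𝕜) R, ∀ x a, T x a = x (e a) := by
  have hr : 0 < r := hp.trans_le hpr
  let L0 : lp (fun _ : β => 𝕜) P →ₗ[𝕜] (α → 𝕜) :=
    { toFun := fun x a => x (e a)
      map_add' := fun x y => by ext b; rfl
      map_smul' := fun c x => by ext b; rfl }
  refine lp_mk R r hR hr L0 1 zero_le_one fun x s => ?_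
  rw [one_mul]
  have h1 : ∀ b, ‖x b‖ ≤ ‖x‖ := fun b => lp.norm_apply_le_norm (zero_lt_one.trans_le Fact.out).ne' x b
  have := lp.sum_rpow_le_norm_rpow (by rw [hP]; exact hp) x (s.map e.toEmbedding)
  rw [Finset.sum_map, hP] at this
  rcases (norm_nonneg x).eq_or_lt with h | h
  · have hx0 : x = 0 := norm_eq_zero.1 h.symm
    subst hx0
    have : ∀ a, L0 0 a = 0 := fun a => rfl
    simp [this, Real.zero_rpow hr.ne']
  calc ∑ a ∈ s, ‖x (e a)‖ ^ r ≤ ∑ a ∈ s, ‖x‖ ^ (r - p) * ‖x (e a)‖ ^ p := by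
        refine Finset.sum_le_sum fun a _ => ?_
        rcases (norm_nonneg (x (e a))).eq_or_lt with h' | h'
        · rw [← h', Real.zero_rpow hr.ne']; positivity
        calc ‖x (e a)‖ ^ r = ‖x (e a)‖ ^ (r - p) * ‖x (e a)‖ ^ p := by
              rw [← Real.rpow_add h']; congr 1; ring
          _ ≤ _ := by
              gcongr
              exact h1 _
    _ ≤ ‖x‖ ^ (r - p) * ‖x‖ ^ p := by
        rw [← Finset.mul_sum]
        gcongr
        exact this
    _ = ‖x‖ ^ r := by rw [← Real.rpow_add h]; congr 1; ring

/-- operators into `c₀` -/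
lemma c0_mk {𝕜 E : Type*} [RCLike 𝕜] [NormedAddCommGroup E] [NormedSpace 𝕜 E]
    (L : E →ₗ[𝕜] (ℕ → 𝕜)) (C : ℝ)
    (h : ∀ x n, ‖L x n‖ ≤ C * ‖x‖) (hlim : ∀ x, Filter.Tendsto (L x) Filter.cofinite (nhds 0)) :
    ∃ T : E →L[𝕜] ZeroAtInftyContinuousMap ℕ 𝕜, ∀ x n, T x n = L x n := by
  let T0 : E →ₗ[𝕜] ZeroAtInftyContinuousMap ℕ 𝕜 :=
    { toFun := fun x => ⟨⟨L x, continuous_of_discreteTopology⟩, by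
        rw [Filter.cocompact_eq_cofinite]; exact hlim x⟩
      map_add' := fun x y => by
        ext b; simp
      map_smul' := fun c x => by
        ext b; simp }
  have hb : ∀ x, ‖T0 x‖ ≤ |C| * ‖x‖ := by
    intro x
    rw [← ZeroAtInftyContinuousMap.norm_toBCF_eq_norm]
    refine (BoundedContinuousFunction.norm_le (by positivity)).2 fun n => (h x n).trans ?_
    gcongr
    exact le_abs_self C
  exact ⟨T0.mkContinuous |C| hb, fun x n => rfl⟩

lemma c0_apply_le {𝕜 : Type*} [RCLike 𝕜] (x : ZeroAtInftyContinuousMap ℕ 𝕜) (n : ℕ) :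
    ‖x n‖ ≤ ‖x‖ := by
  rw [← ZeroAtInftyContinuousMap.norm_toBCF_eq_norm]
  exact BoundedContinuousFunction.norm_coe_le_norm x.toBCF n

lemma lp_tendsto_cofinite {𝕜 α : Type*} [RCLike 𝕜] (P : ℝ≥0∞) 
    (p : ℝ) (hP : P.toReal = p) (hp : 0 < p) (x : lp (fun _ : α => 𝕜) P) :
    Filter.Tendsto (fun a => x a) Filter.cofinite (nhds 0) := by
  have h := ((lp.memℓp x).summable (by rw [hP]; exact hp)).tendsto_cofinite_zero
  rw [hP] at h
  have h2 := h.rpow_const (p := 1 / p) (Or.inr (by positivity))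
  rw [Real.zero_rpow (by positivity)] at h2
  rw [tendsto_zero_iff_norm_tendsto_zero]
  refine h2.congr fun a => ?_
  rw [← Real.rpow_mul (norm_nonneg _)]
  field_simp
  simp

/-- the range package for `S` -/
lemma exists_range {𝕜 : Type*} [RCLike 𝕜] (r : ℝ) (q : ℝ≥0∞)
    (hr1 : 1 < r) (hq : ENNReal.ofReal r ≤ q) [Fact (1 ≤ ENNReal.ofReal r)] [Fact (1 ≤ q)]
    (Y : Type*) [NormedAddCommGroup Y] [NormedSpace 𝕜 Y]
    (hcopy : (q ≠ ∞ ∧ ∃ (J : lp (fun _ : ℕ => 𝕜) q →L[𝕜] Y) (c : ℝ),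
          0 < c ∧ ∀ z, c * ‖z‖ ≤ ‖J z‖)
        ∨ (q = ∞ ∧ ∃ (J : ZeroAtInftyContinuousMap ℕ 𝕜 →L[𝕜] Y) (c : ℝ),
          0 < c ∧ ∀ z, c * ‖z‖ ≤ ‖J z‖))
    {α : Type*} (e : ℕ ≃ α) :
    ∃ (W : lp (fun _ : α => 𝕜) (ENNReal.ofReal r) →L[𝕜] Y) (c : ℝ), 0 < c ∧
      ∀ x a, c * ‖x a‖ ≤ ‖W x‖ := by
  have hr0 : 0 < r := by linarith
  have hP : (ENNReal.ofReal r).toReal = r := ENNReal.toReal_ofReal hr0.le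
  rcases hcopy with ⟨hqt, J, c, hc, hJ⟩ | ⟨hqt, J, c, hc, hJ⟩
  · have hrq : r ≤ q.toReal := by
      rw [← hP]; exact ENNReal.toReal_mono hqt hq
    obtain ⟨T, hT⟩ := exists_reindex (𝕜 := 𝕜) (ENNReal.ofReal r) q r q.toReal hP rfl hr0 hrq e
    refine ⟨J.comp T, c, hc, fun x a => ?_⟩
    refine le_trans ?_ (hJ (T x))
    gcongr
    have := lp.norm_apply_le_norm (zero_lt_one.trans_le Fact.out).ne' (T x) (e.symm a)
    rw [hT] at this
    simpa using this
  · let L0 : lp (fun _ : α => 𝕜) (ENNReal.ofReal r) →ₗ[𝕜] (ℕ → 𝕜) :=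
      { toFun := fun x n => x (e n)
        map_add' := fun x y => by ext b; rfl
        map_smul' := fun c x => by ext b; rfl }
    obtain ⟨T, hT⟩ := c0_mk L0 1 (fun x n => by
        rw [one_mul]; exact lp.norm_apply_le_norm (zero_lt_one.trans_le Fact.out).ne' x _)
      (fun x => (lp_tendsto_cofinite _ r hP hr0 x).comp e.injective.tendsto_cofinite)
    refine ⟨J.comp T, c, hc, fun x a => ?_⟩
    refine le_trans ?_ (hJ (T x))
    gcongr
    have := c0_apply_le (T x) (e.symm a)
    rw [hT] at this
    simpa [L0] using this

/-- weakly 2-summable type condition -/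
def HilbBdd (𝕜 : Type*) {X : Type*} [RCLike 𝕜] [NormedAddCommGroup X] [NormedSpace 𝕜 X] {k : ℕ}
    (x : Fin k → X) : Prop :=
  ∀ a : Fin k → ℝ, ∑ i, a i ^ 2 ≤ 1 → ‖∑ i, (a i : 𝕜) • x i‖ ≤ 1

def RadSmall {𝕜 X Y : Type*} [RCLike 𝕜]
    [NormedAddCommGroup X] [NormedSpace 𝕜 X] [NormedAddCommGroup Y] [NormedSpace 𝕜 Y]
    (R : X →L[𝕜] Y) : Prop :=
  ∀ η : ℝ, 0 < η → ∃ k0 : ℕ, ∀ k, k0 ≤ k → ∀ x : Fin k → X, HilbBdd 𝕜 x →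
    ∑ e : Finset (Fin k), ‖R (∑ i, (rad i e : 𝕜) • x i)‖ ≤ η * (Real.sqrt k * 2 ^ k)

section
variable {𝕜 X Y Z : Type*} [RCLike 𝕜] [NormedAddCommGroup X] [NormedSpace 𝕜 X]
  [NormedAddCommGroup Y] [NormedSpace 𝕜 Y] [NormedAddCommGroup Z] [NormedSpace 𝕜 Z]

lemma HilbBdd.rad_le {k : ℕ} {x : Fin k → X} (hx : HilbBdd 𝕜 x) (e : Finset (Fin k)) :
    ‖∑ i, (rad i e : 𝕜) • x i‖ ≤ Real.sqrt k := by
  rcases Nat.eq_zero_or_pos k with h | h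
  · subst h; simp
  have hk : (0:ℝ) < k := by exact_mod_cast h
  have hs : 0 < Real.sqrt k := Real.sqrt_pos.2 hk
  have := hx (fun i => rad i e / Real.sqrt k) (by
    simp only [div_pow, Real.sq_sqrt hk.le]
    have : ∀ i, rad i e ^ 2 = 1 := fun i => by rw [sq, rad_mul_self]
    simp only [this, Finset.sum_const, Finset.card_univ, Fintype.card_fin, nsmul_eq_mul]
    rw [mul_one_div, div_self hk.ne'])
  have e1 : ∑ i, ((rad i e / Real.sqrt k : ℝ) : 𝕜) • x i
      = (((Real.sqrt k)⁻¹ : ℝ) : 𝕜) • ∑ i, (rad i e : 𝕜) • x i := by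
    rw [Finset.smul_sum]
    refine Finset.sum_congr rfl fun i _ => ?_
    rw [smul_smul]
    congr 1
    push_cast; ring
  rw [e1, norm_smul, RCLike.norm_ofReal, abs_of_pos (by positivity), inv_mul_le_iff₀ hs, mul_one] at this
  exact this

lemma HilbBdd.map {k : ℕ} {x : Fin k → X} (hx : HilbBdd 𝕜 x) (A : X →L[𝕜] Y) (c : ℝ) (hc : 0 < c)
    (hA : ‖A‖ ≤ c) : HilbBdd 𝕜 (fun i => ((c⁻¹ : ℝ) : 𝕜) • A (x i)) := by
  intro a ha
  have : ∑ i, (a i : 𝕜) • (((c⁻¹ : ℝ) : 𝕜) • A (x i)) = ((c⁻¹ : ℝ) : 𝕜) • A (∑ i, (a i : 𝕜) • x i) := by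
    rw [map_sum, Finset.smul_sum]
    refine Finset.sum_congr rfl fun i _ => ?_
    rw [map_smul, smul_comm]
  rw [this, norm_smul, RCLike.norm_ofReal, abs_of_pos (by positivity), inv_mul_le_iff₀ hc, mul_one]
  exact (A.le_opNorm _).trans ((mul_le_of_le_one_right (norm_nonneg _) (hx a ha)).trans hA)

lemma RadSmall.comp_right {R : Y →L[𝕜] Z} (hR : RadSmall R) (A : X →L[𝕜] Y) :
    RadSmall (R.comp A) := by
  intro η hη
  have hc : 0 < ‖A‖ + 1 := by positivity
  obtain ⟨k0, hk0⟩ := hR (η / (‖A‖ + 1)) (by positivity)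
  refine ⟨k0, fun k hk x hx => ?_⟩
  have h := hk0 k hk _ (hx.map A (‖A‖ + 1) hc (by linarith))
  have : ∀ e : Finset (Fin k), ‖R (∑ i, (rad i e : 𝕜) • ((((‖A‖ + 1)⁻¹ : ℝ) : 𝕜) • A (x i)))‖
      = (‖A‖ + 1)⁻¹ * ‖(R.comp A) (∑ i, (rad i e : 𝕜) • x i)‖ := by
    intro e
    have : ∑ i, (rad i e : 𝕜) • ((((‖A‖ + 1)⁻¹ : ℝ) : 𝕜) • A (x i))
        = (((‖A‖ + 1)⁻¹ : ℝ) : 𝕜) • A (∑ i, (rad i e : 𝕜) • x i) := by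
      rw [map_sum, Finset.smul_sum]
      refine Finset.sum_congr rfl fun i _ => ?_
      rw [map_smul, smul_comm]
    rw [this, map_smul, norm_smul, RCLike.norm_ofReal, abs_of_pos (by positivity)]
    rfl
  simp only [this] at h
  rw [← Finset.mul_sum, inv_mul_le_iff₀ hc] at h
  refine h.trans (le_of_eq ?_)
  field_simp

lemma RadSmall.comp_left {R : X →L[𝕜] Y} (hR : RadSmall R) (B : Y →L[𝕜] Z) :
    RadSmall (B.comp R) := by
  intro η hη
  obtain ⟨k0, hk0⟩ := hR (η / (‖B‖ + 1)) (by positivity)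
  refine ⟨k0, fun k hk x hx => ?_⟩
  have h := hk0 k hk x hx
  calc _ ≤ ∑ e : Finset (Fin k), (‖B‖ + 1) * ‖R (∑ i, (rad i e : 𝕜) • x i)‖ := by
        refine Finset.sum_le_sum fun e _ => ?_
        refine (B.le_opNorm _).trans (mul_le_mul_of_nonneg_right ?_ (norm_nonneg _))
        linarith
    _ ≤ (‖B‖ + 1) * (η / (‖B‖ + 1) * (Real.sqrt k * 2 ^ k)) := by
        rw [← Finset.mul_sum]; gcongr
    _ = _ := by field_simp

/-- closed subideal of `RadSmall` operators -/
def radIdeal (𝕜 X Y : Type*) [RCLike 𝕜]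
    [NormedAddCommGroup X] [NormedSpace 𝕜 X] [NormedAddCommGroup Y] [NormedSpace 𝕜 Y] :
    Submodule 𝕜 (X →L[𝕜] Y) where
  carrier := {R | RadSmall R}
  zero_mem' := by
    intro η hη
    refine ⟨0, fun k _ x _ => ?_⟩
    simp only [zero_apply, norm_zero, Finset.sum_const_zero]
    positivity
  add_mem' := by
    intro R R' h h' η hη
    obtain ⟨k0, hk0⟩ := h (η / 2) (by positivity)
    obtain ⟨k1, hk1⟩ := h' (η / 2) (by positivity)
    refine ⟨max k0 k1, fun k hk x hx => ?_⟩
    have e0 := hk0 k (le_trans (le_max_left _ _) hk) x hx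
    have e1 := hk1 k (le_trans (le_max_right _ _) hk) x hx
    calc _ ≤ ∑ e : Finset (Fin k), (‖R (∑ i, (rad i e : 𝕜) • x i)‖
            + ‖R' (∑ i, (rad i e : 𝕜) • x i)‖) :=
          Finset.sum_le_sum fun e _ => norm_add_le _ _
      _ ≤ _ := by rw [Finset.sum_add_distrib]; linarith
  smul_mem' := by
    intro c R h
    have := RadSmall.comp_left h (c • ContinuousLinearMap.id 𝕜 Y)
    have e : (c • ContinuousLinearMap.id 𝕜 Y).comp R = c • R := by ext; simp
    rw [e] at this
    exact this

lemma radIdeal_closed : IsClosed (radIdeal 𝕜 X Y : Set (X →L[𝕜] Y)) := by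
  rw [← isSeqClosed_iff_isClosed]
  intro f R hf hlim η hη
  rw [Metric.tendsto_atTop] at hlim
  obtain ⟨N, hN⟩ := hlim (η / 2) (by positivity)
  have hN := hN N le_rfl
  rw [dist_eq_norm] at hN
  obtain ⟨k0, hk0⟩ := (show RadSmall (f N) from hf N) (η / 2) (by positivity)
  refine ⟨k0, fun k hk x hx => ?_⟩
  have h := hk0 k hk x hx
  calc _ ≤ ∑ e : Finset (Fin k), (‖f N (∑ i, (rad i e : 𝕜) • x i)‖ + η / 2 * Real.sqrt k) := by
        refine Finset.sum_le_sum fun e _ => ?_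
        set v := ∑ i, (rad i e : 𝕜) • x i
        have e1 : R v = f N v - (f N - R) v := by simp
        rw [e1]
        refine (norm_sub_le _ _).trans ?_
        gcongr
        refine ((f N - R).le_opNorm v).trans ?_
        gcongr
        exact hx.rad_le e
    _ ≤ _ := by
        rw [Finset.sum_add_distrib, Finset.sum_const, Finset.card_univ, Fintype.card_finset,
          Fintype.card_fin, nsmul_eq_mul]
        push_cast
        linarith
end

/-- coordinate evaluation on `lp` -/
def lpEval {𝕜 α : Type*} [RCLike 𝕜] (P : ℝ≥0∞) (b : α) : lp (fun _ : α => 𝕜) P →ₗ[𝕜] 𝕜 where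
  toFun x := x b
  map_add' _ _ := rfl
  map_smul' _ _ := rfl

lemma lp_sum_smul_apply {𝕜 α ι : Type*} [RCLike 𝕜] (P : ℝ≥0∞) (s : Finset ι) (c : ι → 𝕜)
    (x : ι → lp (fun _ : α => 𝕜) P) (b : α) :
    (∑ i ∈ s, c i • x i) b = ∑ i ∈ s, c i * x i b := by
  have := map_sum (lpEval P b) (fun i => c i • x i) s
  simp only [map_smul, smul_eq_mul] at this
  exact this

/-- averages of norms in the Walsh blocks -/
lemma walsh_radSmall {𝕜 : Type*} [RCLike 𝕜] (p p' : ℝ) (hp1 : 1 < p) (hp2 : p < 2)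
    (hc : p.HolderConjugate p') [Fact (1 ≤ ENNReal.ofReal p)] [Fact (1 ≤ ENNReal.ofReal p')]
    (V : lp (fun _ : (Σ m : ℕ, Finset (Fin m)) => 𝕜) (ENNReal.ofReal p) →L[𝕜]
      lp (fun _ : (Σ m : ℕ, Finset (Fin m)) => 𝕜) (ENNReal.ofReal p'))
    (hV : ∀ x m s, V x ⟨m, s⟩ = ((((2:ℝ) ^ m) ^ (-(1 / p')) : ℝ) : 𝕜) * ∑ t, (wal s t : 𝕜) * x ⟨m, t⟩)
    : RadSmall V := by
  classical
  have hp0 : 0 < p := by linarith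
  have hp'0 : 0 < p' := hc.symm.pos
  have hP : (ENNReal.ofReal p).toReal = p := ENNReal.toReal_ofReal hp0.le
  have hP' : (ENNReal.ofReal p').toReal = p' := ENNReal.toReal_ofReal hp'0.le
  have hinv : p⁻¹ + p'⁻¹ = 1 := hc.inv_add_inv_eq_one
  have hp'2 : 2 < p' := by
    have h1 : (1:ℝ)/2 < p⁻¹ := by rw [← one_div]; exact one_div_lt_one_div_of_lt hp0 hp2
    have h2 : p'⁻¹ < 1/2 := by linarith
    rw [inv_eq_one_div] at h2
    exact (one_div_lt_one_div hp'0 (by norm_num)).1 h2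
  obtain ⟨C1, hC1, hblock⟩ := block_rad 𝕜 p p' hp1 hp2 hc
  obtain ⟨C2, hC2, hkh⟩ := khinchin_lower 𝕜 p hp0 hp2
  set C := C1 * C2 ^ (2 / p) with hCdef
  have hC : 0 < C := by positivity
  -- main estimate
  have main : ∀ (k : ℕ) (x : Fin k → lp (fun _ : (Σ m : ℕ, Finset (Fin m)) => 𝕜) (ENNReal.ofReal p)),
      HilbBdd 𝕜 x → ∑ e : Finset (Fin k), ‖V (∑ i, (rad i e : 𝕜) • x i)‖ ^ p' ≤ C * k * 2 ^ k := by
    intro k x hx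
    have happ : ∀ (c : Fin k → 𝕜) (b : Σ m : ℕ, Finset (Fin m)),
        (∑ i, c i • x i) b = ∑ i, c i * x i b := by
      intro c b
      exact lp_sum_smul_apply _ _ _ _ _
    set F : (Σ m : ℕ, Finset (Fin m)) → ℝ := fun b => (∑ i, ‖x i b‖ ^ 2) ^ (p / 2) with hF
    have hF0 : ∀ b, 0 ≤ F b := fun b => by positivity
    set M : ℕ → ℝ := fun m => ∑ t : Finset (Fin m), F ⟨m, t⟩ with hM
    have hM0 : ∀ m, 0 ≤ M m := fun m => Finset.sum_nonneg fun t _ => hF0 _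
    set G : ℝ := C2 * (k:ℝ) ^ (p / 2) with hG
    have hG0 : 0 ≤ G := by positivity
    have hFs : ∀ s : Finset (Σ m : ℕ, Finset (Fin m)), ∑ b ∈ s, F b ≤ G := by
      intro s
      have h2k : (0:ℝ) < 2 ^ k := by positivity
      refine le_of_mul_le_mul_left ?_ h2k
      calc (2:ℝ) ^ k * ∑ b ∈ s, F b ≤ ∑ b ∈ s, C2 * ∑ e, ‖∑ i, (rad i e : 𝕜) * x i b‖ ^ p := by
            rw [Finset.mul_sum]
            exact Finset.sum_le_sum fun b _ => hkh k _
        _ = C2 * ∑ e : Finset (Fin k), ∑ b ∈ s, ‖(∑ i, (rad i e : 𝕜) • x i) b‖ ^ p := by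
            rw [← Finset.mul_sum, Finset.sum_comm]
            simp only [happ]
        _ ≤ C2 * ∑ e : Finset (Fin k), (k:ℝ) ^ (p / 2) := by
            gcongr with e _
            have h1 := lp.sum_rpow_le_norm_rpow (by rw [hP]; exact hp0) (∑ i, (rad i e : 𝕜) • x i) s
            rw [hP] at h1
            refine h1.trans ?_
            calc _ ≤ (Real.sqrt k) ^ p := Real.rpow_le_rpow (norm_nonneg _) (hx.rad_le e) hp0.le
              _ = _ := by
                rw [Real.sqrt_eq_rpow, ← Real.rpow_mul (by positivity)]
                congr 1; ring
        _ = _ := by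
            rw [Finset.sum_const, Finset.card_univ, Fintype.card_finset, Fintype.card_fin,
              nsmul_eq_mul, hG]
            push_cast; ring
    have hMs : ∀ K : Finset ℕ, ∑ m ∈ K, M m ≤ G := by
      intro K
      have := hFs (K.sigma fun m => Finset.univ)
      rwa [Finset.sum_sigma] at this
    have hM1 : ∀ m, M m ≤ G := fun m => by simpa using hMs {m}
    have hbl : ∀ m : ℕ, ∑ e : Finset (Fin k), ∑ s : Finset (Fin m),
        ‖V (∑ i, (rad i e : 𝕜) • x i) ⟨m, s⟩‖ ^ p' ≤ C1 * 2 ^ k * (M m) ^ (2 / p) := by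
      intro m
      have hb := hblock m k (fun i t => x i ⟨m, t⟩) (fun a ha => by
        have h1 := lp.sum_rpow_le_norm_rpow (by rw [hP]; exact hp0) (∑ i, (a i : 𝕜) • x i)
          (Finset.univ.map ⟨fun t : Finset (Fin m) => (⟨m, t⟩ : Σ m : ℕ, Finset (Fin m)),
            fun a b hab => by simpa using hab⟩)
        rw [Finset.sum_map, hP] at h1
        simp only [Function.Embedding.coeFn_mk, happ] at h1
        refine h1.trans (Real.rpow_le_one (norm_nonneg _) (hx a ha) hp0.le))
      have h2m : (0:ℝ) < 2 ^ m := by positivity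
      have hn : ∀ (e : Finset (Fin k)) (s : Finset (Fin m)),
          ‖V (∑ i, (rad i e : 𝕜) • x i) ⟨m, s⟩‖ ^ p'
          = ((2:ℝ) ^ m)⁻¹ * ‖∑ t, (wal s t : 𝕜) * ∑ i, (rad i e : 𝕜) * x i ⟨m, t⟩‖ ^ p' := by
        intro e s
        rw [hV, norm_mul, RCLike.norm_ofReal, abs_of_pos (by positivity),
          Real.mul_rpow (by positivity) (norm_nonneg _), ← Real.rpow_mul h2m.le]
        have : -(1 / p') * p' = -1 := by field_simp
        rw [this, Real.rpow_neg_one]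
        simp only [happ]
      simp only [hn, ← Finset.mul_sum]
      rw [inv_mul_le_iff₀ h2m]
      refine hb.trans (le_of_eq ?_)
      rw [hM]; ring
    have hfin : ∀ s : Finset (Σ m : ℕ, Finset (Fin m)),
        ∑ b ∈ s, ∑ e : Finset (Fin k), ‖V (∑ i, (rad i e : 𝕜) • x i) b‖ ^ p' ≤ C * k * 2 ^ k := by
      intro s
      calc _ ≤ ∑ b ∈ (s.image Sigma.fst).sigma (fun m => Finset.univ),
              ∑ e : Finset (Fin k), ‖V (∑ i, (rad i e : 𝕜) • x i) b‖ ^ p' := by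
            refine Finset.sum_le_sum_of_subset_of_nonneg ?_
              fun _ _ _ => Finset.sum_nonneg fun _ _ => by positivity
            intro b hb
            simp only [Finset.mem_sigma, Finset.mem_image, Finset.mem_univ, and_true]
            exact ⟨b, hb, rfl⟩
        _ = ∑ m ∈ s.image Sigma.fst, ∑ e : Finset (Fin k), ∑ t : Finset (Fin m),
              ‖V (∑ i, (rad i e : 𝕜) • x i) ⟨m, t⟩‖ ^ p' := by
            rw [Finset.sum_sigma]
            exact Finset.sum_congr rfl fun m _ => Finset.sum_comm
        _ ≤ ∑ m ∈ s.image Sigma.fst, C1 * 2 ^ k * (G ^ (2 / p - 1) * M m) := by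
            refine Finset.sum_le_sum fun m _ => (hbl m).trans ?_
            refine mul_le_mul_of_nonneg_left (rpow_le_aux _ _ _ (hM0 m) (hM1 m) ?_) (by positivity)
            rw [le_div_iff₀ hp0]; linarith
        _ ≤ C1 * 2 ^ k * (G ^ (2 / p - 1) * G) := by
            rw [← Finset.mul_sum, ← Finset.mul_sum]
            have := hMs (s.image Sigma.fst)
            gcongr
        _ = C1 * 2 ^ k * G ^ (2 / p) := by
            congr 1
            have h1 : 1 < 2 / p := by rw [lt_div_iff₀ hp0]; linarith
            nth_rw 2 [← Real.rpow_one G]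
            rw [← Real.rpow_add_of_nonneg hG0 (by linarith) (by norm_num)]
            congr 1; ring
        _ = _ := by
            rw [hG, Real.mul_rpow hC2.le (by positivity), ← Real.rpow_mul (by positivity), hCdef]
            have : p / 2 * (2 / p) = 1 := by field_simp
            rw [this, Real.rpow_one]; ring
    have hsum : ∀ y : lp (fun _ : (Σ m : ℕ, Finset (Fin m)) => 𝕜) (ENNReal.ofReal p'),
        ‖y‖ ^ p' = ∑' b, ‖y b‖ ^ p' := by
      intro y
      have := lp.norm_rpow_eq_tsum (by rw [hP']; exact hp'0) y
      rwa [hP'] at this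
    have hsummable : ∀ y : lp (fun _ : (Σ m : ℕ, Finset (Fin m)) => 𝕜) (ENNReal.ofReal p'),
        Summable fun b => ‖y b‖ ^ p' := by
      intro y
      have := (lp.memℓp y).summable (by rw [hP']; exact hp'0)
      rwa [hP'] at this
    simp only [hsum]
    rw [← Summable.tsum_finsetSum fun e _ => hsummable _]
    exact (summable_sum fun e _ => hsummable _).tsum_le_of_sum_le hfin
  intro η hη
  have hlim : Filter.Tendsto (fun k : ℕ => (k:ℝ) ^ (p' / 2 - 1)) Filter.atTop Filter.atTop :=
    (tendsto_rpow_atTop (by linarith)).comp tendsto_natCast_atTop_atTop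
  obtain ⟨k0, hk0⟩ := Filter.eventually_atTop.1 (hlim.eventually_ge_atTop (C / η ^ p'))
  refine ⟨k0 + 1, fun k hk x hx => ?_⟩
  have hkpos : (0:ℝ) < k := by exact_mod_cast (by omega : 0 < k)
  have h1 := hk0 k (by omega)
  have h2 := main k x hx
  have hη' : 0 < η ^ p' := by positivity
  rw [div_le_iff₀ hη'] at h1
  refine (Real.rpow_le_rpow_iff (Finset.sum_nonneg fun _ _ => norm_nonneg _) (by positivity) hp'0).1 ?_
  have h3 := Real.rpow_sum_le_const_mul_sum_rpow (Finset.univ : Finset (Finset (Fin k)))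
    (fun e => ‖V (∑ i, (rad i e : 𝕜) • x i)‖) (p := p') (by linarith)
  simp only [abs_norm] at h3
  refine h3.trans ?_
  rw [Finset.card_univ, Fintype.card_finset, Fintype.card_fin]
  push_cast
  have h2k : (0:ℝ) < 2 ^ k := by positivity
  calc _ ≤ ((2:ℝ) ^ k) ^ (p' - 1) * (C * k * 2 ^ k) := by gcongr
    _ ≤ ((2:ℝ) ^ k) ^ (p' - 1) * ((k:ℝ) ^ (p' / 2 - 1) * η ^ p' * k * 2 ^ k) := by gcongr
    _ = η ^ p' * (((k:ℝ) ^ (p' / 2 - 1) * k) * (((2:ℝ) ^ k) ^ (p' - 1) * 2 ^ k)) := by ring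
    _ = η ^ p' * ((k:ℝ) ^ (p' / 2) * ((2:ℝ) ^ k) ^ p') := by
        rw [← Real.rpow_add_one hkpos.ne', ← Real.rpow_add_one h2k.ne']
        ring_nf
    _ = _ := by
        rw [Real.mul_rpow hη.le (by positivity), Real.mul_rpow (by positivity) (by positivity),
          Real.sqrt_eq_rpow, ← Real.rpow_mul hkpos.le]
        congr 3; ring

lemma det_one_add_proj {𝕜 H : Type*} [RCLike 𝕜] [NormedAddCommGroup H] [InnerProductSpace 𝕜 H]
    [FiniteDimensional 𝕜 H] (K : Submodule 𝕜 H) :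
    LinearMap.det ((LinearMap.id : H →ₗ[𝕜] H) + (K.starProjection : H →ₗ[𝕜] H))
      = 2 ^ Module.finrank 𝕜 K := by
  let e := K.prodEquivOfIsCompl _ K.isCompl_orthogonal
  have h : e.symm.toLinearMap ∘ₗ ((LinearMap.id : H →ₗ[𝕜] H) + (K.starProjection : H →ₗ[𝕜] H)) ∘ₗ
      e.symm.symm.toLinearMap
      = LinearMap.prodMap ((2:𝕜) • LinearMap.id) LinearMap.id := by
    apply LinearMap.ext
    rintro ⟨a, b⟩
    simp only [LinearMap.comp_apply, LinearEquiv.coe_coe]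
    rw [LinearEquiv.symm_apply_eq]
    simp only [e, LinearEquiv.symm_symm, Submodule.coe_prodEquivOfIsCompl', LinearMap.add_apply,
      LinearMap.id_apply, ContinuousLinearMap.coe_coe, map_add, LinearMap.prodMap_apply,
      LinearMap.smul_apply, Submodule.coe_smul]
    rw [Submodule.starProjection_eq_self_iff.2 a.2,
      (Submodule.starProjection_apply_eq_zero_iff K).2 b.2, two_smul]
    abel
  rw [← LinearMap.det_conj _ e.symm, h, LinearMap.det_prodMap, LinearMap.det_smul, LinearMap.det_id,
    LinearMap.det_id]
  simp

/-- maximal volume map -/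
lemma exists_lewis {𝕜 E : Type*} [RCLike 𝕜] [NormedAddCommGroup E] [NormedSpace 𝕜 E]
    [FiniteDimensional 𝕜 E] (N : ℕ) (hN : Module.finrank 𝕜 E = N) :
    ∃ u : EuclideanSpace 𝕜 (Fin N) →L[𝕜] E, ‖u‖ ≤ 1 ∧
      ∀ K : Submodule 𝕜 (EuclideanSpace 𝕜 (Fin N)), (∀ a ∈ K, ‖u a‖ ≤ 1 / 3 * ‖a‖) →
        (2:ℝ) ^ Module.finrank 𝕜 K ≤ (4 / 3) ^ N := by
  haveI : FiniteDimensional 𝕜 (EuclideanSpace 𝕜 (Fin N) →L[𝕜] E) := inferInstance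
  haveI : ProperSpace (EuclideanSpace 𝕜 (Fin N) →L[𝕜] E) := FiniteDimensional.proper 𝕜 _
  let ψ : E ≃ₗ[𝕜] EuclideanSpace 𝕜 (Fin N) := LinearEquiv.ofFinrankEq _ _ (by simp [hN])
  let Ψ : E ≃L[𝕜] EuclideanSpace 𝕜 (Fin N) := ψ.toContinuousLinearEquiv
  let f : (EuclideanSpace 𝕜 (Fin N) →L[𝕜] E) → ℝ := fun u => ‖((Ψ : E →L[𝕜] _).comp u).det‖
  have hf : Continuous f := by
    refine continuous_norm.comp (ContinuousLinearMap.continuous_det.comp ?_)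
    exact continuous_const.clm_comp continuous_id
  obtain ⟨u, hu, hmax⟩ := (isCompact_closedBall (0 : EuclideanSpace 𝕜 (Fin N) →L[𝕜] E) 1).exists_isMaxOn
    ⟨0, by simp⟩ hf.continuousOn
  have hu1 : ‖u‖ ≤ 1 := by simpa using hu
  have hmax' : ∀ v : EuclideanSpace 𝕜 (Fin N) →L[𝕜] E, ‖v‖ ≤ 1 → f v ≤ f u := by
    intro v hv
    exact hmax (by simpa using hv)
  have hpos : 0 < f u := by
    let w : EuclideanSpace 𝕜 (Fin N) →L[𝕜] E := Ψ.symm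
    set c : ℝ := (‖w‖ + 1)⁻¹ with hc
    have hcpos : 0 < c := by positivity
    have h1 : ‖((c : ℝ) : 𝕜) • w‖ ≤ 1 := by
      rw [norm_smul, RCLike.norm_ofReal, abs_of_pos hcpos, hc, inv_mul_le_iff₀ (by positivity)]
      linarith
    refine lt_of_lt_of_le ?_ (hmax' _ h1)
    have : (Ψ : E →L[𝕜] _).comp (((c : ℝ) : 𝕜) • w)
        = ((c : ℝ) : 𝕜) • ContinuousLinearMap.id 𝕜 (EuclideanSpace 𝕜 (Fin N)) := by
      ext1 x
      simp [w]
    simp only [f, this]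
    rw [ContinuousLinearMap.det, ContinuousLinearMap.toLinearMap_smul, LinearMap.det_smul]
    simp [hcpos.ne']
  refine ⟨u, hu1, fun K hK => ?_⟩
  set A : EuclideanSpace 𝕜 (Fin N) →L[𝕜] EuclideanSpace 𝕜 (Fin N) :=
    ContinuousLinearMap.id 𝕜 _ + K.starProjection with hA
  have hb : ‖(((3 / 4 : ℝ)) : 𝕜) • u.comp A‖ ≤ 1 := by
    rw [norm_smul, RCLike.norm_ofReal, abs_of_pos (by norm_num)]
    have : ‖u.comp A‖ ≤ 4 / 3 := by
      refine ContinuousLinearMap.opNorm_le_bound _ (by norm_num) fun a => ?_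
      have e1 : (u.comp A) a = u a + u (K.starProjection a) := by simp [hA]
      rw [e1]
      have h1 : ‖u a‖ ≤ ‖a‖ := by simpa using u.le_of_opNorm_le hu1 a
      have h2 := hK (K.starProjection a) (Submodule.starProjection_apply_mem K a)
      have h3 : ‖K.starProjection a‖ ≤ ‖a‖ := K.norm_starProjection_apply_le a
      have := norm_add_le (u a) (u (K.starProjection a))
      linarith
    linarith
  have h := hmax' _ hb
  have hcomp : f ((((3 / 4 : ℝ)) : 𝕜) • u.comp A)
      = (3 / 4) ^ N * (f u * 2 ^ Module.finrank 𝕜 K) := by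
    have : (Ψ : E →L[𝕜] EuclideanSpace 𝕜 (Fin N)).comp ((((3 / 4 : ℝ)) : 𝕜) • u.comp A)
        = (((3 / 4 : ℝ)) : 𝕜) • ((Ψ : E →L[𝕜] EuclideanSpace 𝕜 (Fin N)).comp u).comp A := by
      ext1 x; simp
    simp only [f, this]
    rw [ContinuousLinearMap.det, ContinuousLinearMap.toLinearMap_smul, LinearMap.det_smul,
      ContinuousLinearMap.toLinearMap_comp, LinearMap.det_comp]
    have hA2 : (A : EuclideanSpace 𝕜 (Fin N) →ₗ[𝕜] EuclideanSpace 𝕜 (Fin N)) =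
      (LinearMap.id : _ →ₗ[𝕜] _) + (K.starProjection : _ →ₗ[𝕜] _) := rfl
    rw [hA2, det_one_add_proj, norm_mul, norm_mul, norm_pow, norm_pow, RCLike.norm_ofReal,
      finrank_euclideanSpace_fin, abs_of_pos (by norm_num)]
    simp [ContinuousLinearMap.det]
  rw [hcomp] at h
  have h2 : (3 / 4 : ℝ) ^ N * 2 ^ Module.finrank 𝕜 K ≤ 1 := by
    refine le_of_mul_le_mul_left ?_ hpos
    linarith
  have h3 : (4 / 3 : ℝ) ^ N * (3 / 4 : ℝ) ^ N = 1 := by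
    rw [← mul_pow]; norm_num
  calc (2:ℝ) ^ Module.finrank 𝕜 K = (4 / 3 : ℝ) ^ N * ((3 / 4 : ℝ) ^ N * 2 ^ Module.finrank 𝕜 K) := by
        rw [← mul_assoc, h3, one_mul]
    _ ≤ (4 / 3 : ℝ) ^ N * 1 := by gcongr
    _ = _ := mul_one _

/-- Dvoretzky-Rogers lemma -/
lemma dvoretzky_rogers {𝕜 E : Type*} [RCLike 𝕜] [NormedAddCommGroup E] [NormedSpace 𝕜 E]
    [FiniteDimensional 𝕜 E] (k : ℕ) (hN : Module.finrank 𝕜 E = 2 * k) :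
    ∃ x : Fin k → E, HilbBdd 𝕜 x ∧ ∀ i, 1 / 3 ≤ ‖x i‖ := by
  obtain ⟨u, hu, hK⟩ := exists_lewis (2 * k) hN
  have step : ∀ j, j ≤ k → ∃ a : Fin j → EuclideanSpace 𝕜 (Fin (2 * k)),
      Orthonormal 𝕜 a ∧ ∀ i, 1 / 3 ≤ ‖u (a i)‖ := by
    intro j
    induction j with
    | zero => exact fun _ => ⟨Fin.elim0, ⟨fun i => i.elim0, fun i => i.elim0⟩, fun i => i.elim0⟩
    | succ j ih =>
      intro hj
      obtain ⟨a, ha, hua⟩ := ih (by omega)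
      set K := (Submodule.span 𝕜 (Set.range a))ᗮ with hKdef
      have hdim : k ≤ Module.finrank 𝕜 K := by
        have h1 := Submodule.finrank_add_finrank_orthogonal (Submodule.span 𝕜 (Set.range a))
        rw [finrank_euclideanSpace_fin] at h1
        have h2 : Module.finrank 𝕜 (Submodule.span 𝕜 (Set.range a)) ≤ j := by
          exact (finrank_range_le_card (R := 𝕜) a).trans (by simp)
        rw [← hKdef] at h1
        omega
      have hex : ∃ b ∈ K, 1 / 3 * ‖b‖ < ‖u b‖ := by
        by_contra! hcon
        have h1 := hK K hcon
        have h2 : (2:ℝ) ^ k ≤ 2 ^ Module.finrank 𝕜 K := pow_le_pow_right₀ (by norm_num) hdim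
        have h3 : (4 / 3 : ℝ) ^ (2 * k) = (16 / 9) ^ k := by
          rw [pow_mul]; norm_num
        have h4 : (16 / 9 : ℝ) ^ k < 2 ^ k := pow_lt_pow_left₀ (by norm_num) (by norm_num) (by omega)
        linarith
      obtain ⟨b, hbK, hb⟩ := hex
      have hbpos : 0 < ‖b‖ := by
        rcases (norm_nonneg b).eq_or_lt with h | h
        · have : b = 0 := norm_eq_zero.1 h.symm
          rw [this] at hb; simp at hb
        · exact h
      refine ⟨Matrix.vecCons (((‖b‖⁻¹ : ℝ) : 𝕜) • b) a, ?_, ?_⟩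
      · rw [orthonormal_vecCons_iff]
        refine ⟨?_, fun i => ?_, ha⟩
        · rw [norm_smul, RCLike.norm_ofReal, abs_of_pos (by positivity), inv_mul_cancel₀ hbpos.ne']
        · rw [inner_smul_left]
          have : inner 𝕜 b (a i) = 0 :=
            (Submodule.mem_orthogonal' _ _).1 hbK (a i) (Submodule.subset_span ⟨i, rfl⟩)
          rw [this, mul_zero]
      · intro i
        refine Fin.cases ?_ (fun i => ?_) i
        · simp only [Matrix.cons_val_zero]
          rw [map_smul, norm_smul, RCLike.norm_ofReal, abs_of_pos (by positivity),
            inv_mul_eq_div, le_div_iff₀ hbpos]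
          exact hb.le
        · simpa using hua i
  obtain ⟨a, ha, hua⟩ := step k le_rfl
  refine ⟨fun i => u (a i), fun c hc => ?_, hua⟩
  have e1 : ∑ i, (c i : 𝕜) • u (a i) = u (∑ i, (c i : 𝕜) • a i) := by
    rw [map_sum]; exact Finset.sum_congr rfl fun i _ => by rw [map_smul]
  rw [e1]
  have h1 : ‖∑ i, (c i : 𝕜) • a i‖ ^ 2 ≤ 1 := by
    have := ha.inner_sum (fun i => (c i : 𝕜)) (fun i => (c i : 𝕜)) Finset.univ
    rw [inner_self_eq_norm_sq_to_K] at this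
    have h2 : ((‖∑ i, (c i : 𝕜) • a i‖ ^ 2 : ℝ) : 𝕜) = ((∑ i, c i ^ 2 : ℝ) : 𝕜) := by
      push_cast
      rw [this]
      refine Finset.sum_congr rfl fun i _ => ?_
      rw [RCLike.conj_ofReal, sq]
    rw [RCLike.ofReal_inj.1 h2]; exact hc
  have h2 : ‖∑ i, (c i : 𝕜) • a i‖ ≤ 1 := by
    have := norm_nonneg (∑ i, (c i : 𝕜) • a i)
    nlinarith
  calc _ ≤ ‖u‖ * ‖∑ i, (c i : 𝕜) • a i‖ := u.le_opNorm _
    _ ≤ 1 * 1 := by gcongr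
    _ = 1 := one_mul 1

lemma power_mean_aux {𝕜 : Type*} [RCLike 𝕜] (p : ℝ) (hp : 0 < p) (hp2 : p < 2) (k : ℕ) (a : Fin k → 𝕜) :
    ∑ i, ‖a i‖ ^ p ≤ (k:ℝ) ^ (1 - p / 2) * (∑ i, ‖a i‖ ^ 2) ^ (p / 2) := by
  have h1 : 1 ≤ 2 / p := by rw [le_div_iff₀ hp]; linarith
  have h := Real.rpow_sum_le_const_mul_sum_rpow (Finset.univ) (fun i => ‖a i‖ ^ p) h1
  have e1 : ∀ i, |‖a i‖ ^ p| = ‖a i‖ ^ p := fun i => abs_of_nonneg (by positivity)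
  have e2 : ∀ i, (‖a i‖ ^ p) ^ (2 / p) = ‖a i‖ ^ 2 := fun i => by
    rw [← Real.rpow_mul (norm_nonneg _), mul_div_cancel₀ _ hp.ne']; norm_cast
  simp only [e1, e2, Finset.card_univ, Fintype.card_fin] at h
  have hS : 0 ≤ ∑ i, ‖a i‖ ^ p := Finset.sum_nonneg fun i _ => by positivity
  have h2 := Real.rpow_le_rpow (by positivity) h (show 0 ≤ p / 2 by positivity)
  rw [← Real.rpow_mul hS, Real.mul_rpow (by positivity) (Finset.sum_nonneg fun i _ => by positivity),
    ← Real.rpow_mul (by positivity)] at h2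
  have e3 : 2 / p * (p / 2) = 1 := by field_simp
  have e4 : (2 / p - 1) * (p / 2) = 1 - p / 2 := by field_simp
  rwa [e3, e4, Real.rpow_one] at h2

lemma lp_cotype (𝕜 : Type*) [RCLike 𝕜] (p : ℝ) (hp1 : 1 < p) (hp2 : p < 2)
    [Fact (1 ≤ ENNReal.ofReal p)] (α : Type*) :
    ∃ C : ℝ, 0 < C ∧ ∀ (k : ℕ) (x : Fin k → lp (fun _ : α => 𝕜) (ENNReal.ofReal p)),
      2 ^ k * ∑ i, ‖x i‖ ^ p ≤ C * (k:ℝ) ^ (1 - p / 2) *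
        ∑ e : Finset (Fin k), ‖∑ i, (rad i e : 𝕜) • x i‖ ^ p := by
  have hp0 : 0 < p := by linarith
  have hP : (ENNReal.ofReal p).toReal = p := ENNReal.toReal_ofReal hp0.le
  obtain ⟨C, hC, hK⟩ := khinchin_lower 𝕜 p hp0 hp2
  refine ⟨C, hC, fun k x => ?_⟩
  have hs : ∀ y : lp (fun _ : α => 𝕜) (ENNReal.ofReal p), HasSum (fun b => ‖y b‖ ^ p) (‖y‖ ^ p) := by
    intro y
    have := lp.hasSum_norm (by rw [hP]; exact hp0) y
    rwa [hP] at this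
  have h1 := (hasSum_sum (s := Finset.univ) fun i _ => hs (x i)).mul_left ((2:ℝ) ^ k)
  have h2 := (hasSum_sum (s := Finset.univ) fun (e : Finset (Fin k)) _ =>
    hs (∑ i, (rad i e : 𝕜) • x i)).mul_left (C * (k:ℝ) ^ (1 - p / 2))
  refine hasSum_le (fun b => ?_) h1 h2
  have h3 := power_mean_aux p hp0 hp2 k (fun i => x i b)
  have h4 := hK k (fun i => x i b)
  simp only [lp_sum_smul_apply]
  calc _ ≤ (2:ℝ) ^ k * ((k:ℝ) ^ (1 - p / 2) * (∑ i, ‖x i b‖ ^ 2) ^ (p / 2)) := by gcongr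
    _ = (k:ℝ) ^ (1 - p / 2) * (2 ^ k * (∑ i, ‖x i b‖ ^ 2) ^ (p / 2)) := by ring
    _ ≤ (k:ℝ) ^ (1 - p / 2) * (C * ∑ s, ‖∑ i, (rad i s : 𝕜) * x i b‖ ^ p) := by gcongr
    _ = _ := by ring

lemma fss_of_radSmall {𝕜 : Type*} [RCLike 𝕜] (p : ℝ) (hp1 : 1 < p) (hp2 : p < 2)
    [Fact (1 ≤ ENNReal.ofReal p)] {α Y : Type*} [NormedAddCommGroup Y] [NormedSpace 𝕜 Y]
    (V : lp (fun _ : α => 𝕜) (ENNReal.ofReal p) →L[𝕜] Y) (hV : RadSmall V) :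
    ∀ δ : ℝ, 0 < δ → ∃ n : ℕ, 0 < n ∧ ∀ E : Submodule 𝕜 (lp (fun _ : α => 𝕜) (ENNReal.ofReal p)),
      Module.finrank 𝕜 E = n → ∃ x ∈ E, x ≠ 0 ∧ ‖V x‖ < δ * ‖x‖ := by
  intro δ hδ
  have hp0 : 0 < p := by linarith
  obtain ⟨C, hC, hcot⟩ := lp_cotype 𝕜 p hp1 hp2 α
  set η : ℝ := δ * (C⁻¹ * (1 / 3 : ℝ) ^ p) / 2 with hη
  have hηpos : 0 < η := by positivity
  obtain ⟨k0, hk0⟩ := hV η hηpos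
  set k := k0 + 1 with hk
  have hkpos : (0:ℝ) < k := by rw [hk]; positivity
  refine ⟨2 * k, by omega, fun E hE => ?_⟩
  have hfd : FiniteDimensional 𝕜 E := FiniteDimensional.of_finrank_pos (by omega)
  obtain ⟨x, hx, hxn⟩ := dvoretzky_rogers k hE
  have hx' : HilbBdd 𝕜 (fun i => (x i : lp (fun _ : α => 𝕜) (ENNReal.ofReal p))) := by
    intro a ha
    have := hx a ha
    have e : ((∑ i, (a i : 𝕜) • x i : E) : lp (fun _ : α => 𝕜) (ENNReal.ofReal p))
        = ∑ i, (a i : 𝕜) • (x i : lp (fun _ : α => 𝕜) (ENNReal.ofReal p)) := by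
      rw [Submodule.coe_sum]
      exact Finset.sum_congr rfl fun i _ => rfl
    rw [← e]
    exact this
  have hsmall := hk0 k (by omega) _ hx'
  have hc := hcot k (fun i => (x i : lp (fun _ : α => 𝕜) (ENNReal.ofReal p)))
  set z : Finset (Fin k) → lp (fun _ : α => 𝕜) (ENNReal.ofReal p) :=
    fun e => ∑ i, (rad i e : 𝕜) • (x i : lp (fun _ : α => 𝕜) (ENNReal.ofReal p)) with hz
  have hzE : ∀ e, z e ∈ E := fun e => Submodule.sum_mem _ fun i _ => E.smul_mem _ (x i).2
  by_contra! hcon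
  have hge : ∀ e, δ * ‖z e‖ ≤ ‖V (z e)‖ := by
    intro e
    by_cases h : z e = 0
    · rw [h]; simp
    · exact hcon _ (hzE e) h
  have hzle : ∀ e, ‖z e‖ ≤ Real.sqrt k := fun e => hx'.rad_le e
  have hzp : ∀ e, ‖z e‖ ^ p ≤ (Real.sqrt k) ^ (p - 1) * ‖z e‖ := fun e =>
    rpow_le_aux _ _ p (norm_nonneg _) (hzle e) hp1.le
  have hlow : (k:ℝ) * (1 / 3) ^ p ≤ ∑ i, ‖(x i : lp (fun _ : α => 𝕜) (ENNReal.ofReal p))‖ ^ p := by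
    calc (k:ℝ) * (1 / 3) ^ p = ∑ i : Fin k, (1 / 3 : ℝ) ^ p := by simp
      _ ≤ _ := by
        refine Finset.sum_le_sum fun i _ => ?_
        have := hxn i
        have : (1 / 3 : ℝ) ≤ ‖(x i : lp (fun _ : α => 𝕜) (ENNReal.ofReal p))‖ := this
        gcongr
  have hsum : ∑ e, ‖z e‖ ^ p ≤ (Real.sqrt k) ^ (p - 1) * ∑ e, ‖z e‖ := by
    rw [Finset.mul_sum]; exact Finset.sum_le_sum fun e _ => hzp e
  have hk1 : (k:ℝ) ^ (1 - p / 2) * (Real.sqrt k) ^ (p - 1) = Real.sqrt k := by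
    rw [Real.sqrt_eq_rpow, ← Real.rpow_mul hkpos.le, ← Real.rpow_add hkpos]
    congr 1; ring
  have h1 : (2:ℝ) ^ k * (k * (1 / 3) ^ p) ≤ C * (Real.sqrt k * ∑ e, ‖z e‖) := by
    calc (2:ℝ) ^ k * (k * (1 / 3) ^ p) ≤ _ := mul_le_mul_of_nonneg_left hlow (by positivity)
      _ ≤ _ := hc
      _ ≤ C * (k:ℝ) ^ (1 - p / 2) * ((Real.sqrt k) ^ (p - 1) * ∑ e, ‖z e‖) :=
          mul_le_mul_of_nonneg_left hsum (by positivity)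
      _ = C * (((k:ℝ) ^ (1 - p / 2) * (Real.sqrt k) ^ (p - 1)) * ∑ e, ‖z e‖) := by ring
      _ = _ := by rw [hk1]
  have hsk : 0 < Real.sqrt k := Real.sqrt_pos.2 hkpos
  have h2 : (2:ℝ) ^ k * (Real.sqrt k * (1 / 3) ^ p) ≤ C * ∑ e, ‖z e‖ := by
    refine le_of_mul_le_mul_left ?_ hsk
    calc Real.sqrt k * ((2:ℝ) ^ k * (Real.sqrt k * (1 / 3) ^ p))
        = (2:ℝ) ^ k * ((Real.sqrt k * Real.sqrt k) * (1 / 3) ^ p) := by ring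
      _ = (2:ℝ) ^ k * (k * (1 / 3) ^ p) := by rw [Real.mul_self_sqrt hkpos.le]
      _ ≤ _ := h1
      _ = _ := by ring
  have h3 : δ * ∑ e, ‖z e‖ ≤ η * (Real.sqrt k * 2 ^ k) := by
    refine le_trans ?_ hsmall
    rw [Finset.mul_sum]
    exact Finset.sum_le_sum fun e _ => hge e
  have h4 : δ * ((2:ℝ) ^ k * (Real.sqrt k * (1 / 3) ^ p)) ≤ C * (η * (Real.sqrt k * 2 ^ k)) := by
    calc _ ≤ δ * (C * ∑ e, ‖z e‖) := mul_le_mul_of_nonneg_left h2 hδ.le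
      _ = C * (δ * ∑ e, ‖z e‖) := by ring
      _ ≤ _ := mul_le_mul_of_nonneg_left h3 hC.le
  have h5 : C * (η * (Real.sqrt k * 2 ^ k)) = δ * ((2:ℝ) ^ k * (Real.sqrt k * (1 / 3) ^ p)) / 2 := by
    rw [hη]; field_simp
  rw [h5] at h4
  have : 0 < δ * ((2:ℝ) ^ k * (Real.sqrt k * (1 / 3) ^ p)) := by positivity
  linarith

lemma fss_comp {𝕜 : Type*} [RCLike 𝕜] {X Z W Y : Type*}
    [NormedAddCommGroup X] [NormedSpace 𝕜 X] [NormedAddCommGroup Z] [NormedSpace 𝕜 Z]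
    [NormedAddCommGroup W] [NormedSpace 𝕜 W] [NormedAddCommGroup Y] [NormedSpace 𝕜 Y]
    (V : Z →L[𝕜] W) (A : X →L[𝕜] Z) (B : W →L[𝕜] Y)
    (h : ∀ δ : ℝ, 0 < δ → ∃ n : ℕ, 0 < n ∧ ∀ E : Submodule 𝕜 Z,
      Module.finrank 𝕜 E = n → ∃ x ∈ E, x ≠ 0 ∧ ‖V x‖ < δ * ‖x‖) :
    FinStrictSing (B.comp (V.comp A)) := by
  intro ε hε
  obtain ⟨n, hn, hE⟩ := h (ε / ((‖B‖ + 1) * (‖A‖ + 1))) (by positivity)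
  refine ⟨n, fun E hEn => ?_⟩
  have hfd : FiniteDimensional 𝕜 E := FiniteDimensional.of_finrank_pos (by omega)
  by_cases hinj : ∀ x ∈ E, A x = 0 → x = 0
  · have hinj' : Function.Injective ((A : X →ₗ[𝕜] Z).domRestrict E) := by
      rw [injective_iff_map_eq_zero]
      intro x hx
      exact Subtype.ext (hinj x x.2 hx)
    have hr : Module.finrank 𝕜 (LinearMap.range ((A : X →ₗ[𝕜] Z).domRestrict E)) = n := by
      rw [LinearMap.finrank_range_of_inj hinj', hEn]
    obtain ⟨y, ⟨x, rfl⟩, hy0, hy⟩ := hE _ hr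
    refine ⟨x, x.2, fun h0 => hy0 (by simp [h0]), ?_⟩
    have hy : ‖V (A x)‖ < ε / ((‖B‖ + 1) * (‖A‖ + 1)) * ‖A x‖ := hy
    change ‖B (V (A x))‖ < _
    have h1 : ‖A x‖ ≤ (‖A‖ + 1) * ‖(x : X)‖ := (A.le_opNorm _).trans (by gcongr; linarith)
    calc ‖B (V (A x))‖ ≤ (‖B‖ + 1) * ‖V (A x)‖ := (B.le_opNorm _).trans (by gcongr; linarith)
      _ < (‖B‖ + 1) * (ε / ((‖B‖ + 1) * (‖A‖ + 1)) * ‖A x‖) := by gcongr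
      _ ≤ (‖B‖ + 1) * (ε / ((‖B‖ + 1) * (‖A‖ + 1)) * ((‖A‖ + 1) * ‖(x : X)‖)) := by gcongr
      _ = _ := by field_simp
  · push Not at hinj
    obtain ⟨x, hx, hA, hx0⟩ := hinj
    refine ⟨x, hx, hx0, ?_⟩
    simp only [ContinuousLinearMap.comp_apply, hA, map_zero, norm_zero]
    positivity

open Classical in
def sgl {𝕜 α : Type*} [RCLike 𝕜] (P : ℝ≥0∞) (a : α) : lp (fun _ : α => 𝕜) P :=
  lp.single P a (1:𝕜)

lemma sgl_self {𝕜 α : Type*} [RCLike 𝕜] (P : ℝ≥0∞) (a : α) : (sgl P a : lp (fun _ : α => 𝕜) P) a = 1 := by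
  classical exact lp.single_apply_self _ _ _

lemma sgl_ne {𝕜 α : Type*} [RCLike 𝕜] (P : ℝ≥0∞) (a b : α) (h : b ≠ a) :
    (sgl P a : lp (fun _ : α => 𝕜) P) b = 0 := by
  classical exact lp.single_apply_ne _ _ _ h

def blockInj {𝕜 : Type*} [RCLike 𝕜] (P : ℝ≥0∞) {A : ℕ → Type} [∀ k, Fintype (A k)] (m : ℕ) :
    (A m → 𝕜) →ₗ[𝕜] lp (fun _ : (Σ k, A k) => 𝕜) P where
  toFun c := ∑ a, c a • sgl P (⟨m, a⟩ : Σ k, A k)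
  map_add' c d := by simp [add_smul, Finset.sum_add_distrib]
  map_smul' r c := by simp [mul_smul, Finset.smul_sum]

lemma blockInj_apply {𝕜 : Type*} [RCLike 𝕜] (P : ℝ≥0∞) {A : ℕ → Type} [∀ k, Fintype (A k)] (m : ℕ)
    (c : A m → 𝕜) (a : A m) : blockInj P m c ⟨m, a⟩ = c a := by
  classical
  have : blockInj P m c ⟨m, a⟩ = ∑ b, c b * (sgl P (⟨m, b⟩ : Σ k, A k) : lp (fun _ : (Σ k, A k) => 𝕜) P) ⟨m, a⟩ :=
    lp_sum_smul_apply P _ _ _ _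
  rw [this, Finset.sum_eq_single a]
  · rw [sgl_self, mul_one]
  · intro b _ hb
    rw [sgl_ne, mul_zero]
    intro h; apply hb; simpa using h.symm
  · simp

lemma blockInj_apply_ne {𝕜 : Type*} [RCLike 𝕜] (P : ℝ≥0∞) {A : ℕ → Type} [∀ k, Fintype (A k)] (m : ℕ)
    (c : A m → 𝕜) (k : ℕ) (hk : k ≠ m) (a : A k) : blockInj P m c ⟨k, a⟩ = 0 := by
  classical
  have : blockInj P m c ⟨k, a⟩ = ∑ b, c b * (sgl P (⟨m, b⟩ : Σ k, A k) : lp (fun _ : (Σ k, A k) => 𝕜) P) ⟨k, a⟩ :=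
    lp_sum_smul_apply P _ _ _ _
  rw [this]
  refine Finset.sum_eq_zero fun b _ => ?_
  rw [sgl_ne, mul_zero]
  intro h
  exact hk (congrArg Sigma.fst h)

lemma blockInj_norm {𝕜 : Type*} [RCLike 𝕜] (P : ℝ≥0∞) (p : ℝ) (hP : P.toReal = p) (hp : 0 < p)
    {A : ℕ → Type} [∀ k, Fintype (A k)] (m : ℕ)
    (c : A m → 𝕜) : ‖blockInj P m c‖ ^ p = ∑ a, ‖c a‖ ^ p := by
  have h1 := lp.hasSum_norm (by rw [hP]; exact hp) (blockInj P m c)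
  rw [hP] at h1
  have h2 := hasSum_sum_of_ne_finset_zero (f := fun b => ‖blockInj P m c b‖ ^ p)
    (s := Finset.univ.map (Function.Embedding.sigmaMk m)) (L := SummationFilter.unconditional _) (by
      rintro ⟨k, a⟩ hb
      by_cases hk : k = m
      · subst hk; exact absurd (by simp) hb
      · rw [blockInj_apply_ne P m c k hk a, norm_zero, Real.zero_rpow hp.ne'])
  rw [h1.unique h2, Finset.sum_map]
  refine Finset.sum_congr rfl fun a _ => ?_
  rw [← blockInj_apply P m c a]; rfl

/-- a quadratic Walsh estimate for operators in the span -/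
lemma span_walsh {𝕜 X Y : Type*} [RCLike 𝕜]
    [NormedAddCommGroup X] [NormedSpace 𝕜 X] [NormedAddCommGroup Y] [NormedSpace 𝕜 Y]
    (R : X →L[𝕜] Y) (hR : R ∈ Submodule.span 𝕜 {T : X →L[𝕜] Y | FactorsThroughEllTwo T}) :
    ∃ C : ℝ, 0 ≤ C ∧ ∀ (m : ℕ) (x : Finset (Fin m) → X),
      ∑ s, ‖R (∑ t, (wal s t : 𝕜) • x t)‖ ^ 2 ≤ C * (2 ^ m * ∑ t, ‖x t‖ ^ 2) := by
  induction hR using Submodule.span_induction with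
  | mem R h =>
    obtain ⟨A, B, rfl⟩ := h
    refine ⟨‖B‖ ^ 2 * ‖A‖ ^ 2, by positivity, fun m x => ?_⟩
    have h1 := wal_parseval (𝕜 := 𝕜) (fun t => A (x t))
    calc _ ≤ ∑ s : Finset (Fin m), ‖B‖ ^ 2 * ‖∑ t, (wal s t : 𝕜) • A (x t)‖ ^ 2 := by
          refine Finset.sum_le_sum fun s _ => ?_
          rw [← mul_pow]
          refine pow_le_pow_left₀ (norm_nonneg _) ?_ 2
          have : A (∑ t, (wal s t : 𝕜) • x t) = ∑ t, (wal s t : 𝕜) • A (x t) := by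
            rw [map_sum]; exact Finset.sum_congr rfl fun t _ => by rw [map_smul]
          rw [ContinuousLinearMap.comp_apply, this]
          exact B.le_opNorm _
      _ = ‖B‖ ^ 2 * (2 ^ m * ∑ t, ‖A (x t)‖ ^ 2) := by rw [← Finset.mul_sum, h1]
      _ ≤ ‖B‖ ^ 2 * (2 ^ m * ∑ t, ‖A‖ ^ 2 * ‖x t‖ ^ 2) := by
          gcongr with t
          rw [← mul_pow]
          exact pow_le_pow_left₀ (norm_nonneg _) (A.le_opNorm _) 2
      _ = _ := by rw [← Finset.mul_sum]; ring
  | zero => exact ⟨0, le_rfl, fun m x => by simp⟩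
  | add R1 R2 _ _ h1 h2 =>
    obtain ⟨C1, hC1, h1⟩ := h1
    obtain ⟨C2, hC2, h2⟩ := h2
    refine ⟨2 * (C1 + C2), by positivity, fun m x => ?_⟩
    have e1 := h1 m x
    have e2 := h2 m x
    calc _ ≤ ∑ s : Finset (Fin m), 2 * (‖R1 (∑ t, (wal s t : 𝕜) • x t)‖ ^ 2
            + ‖R2 (∑ t, (wal s t : 𝕜) • x t)‖ ^ 2) := by
          refine Finset.sum_le_sum fun s _ => ?_
          have h := norm_add_le (R1 (∑ t, (wal s t : 𝕜) • x t)) (R2 (∑ t, (wal s t : 𝕜) • x t))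
          have h' := pow_le_pow_left₀ (norm_nonneg _) h 2
          refine h'.trans ?_
          exact add_sq_le
      _ = 2 * (∑ s : Finset (Fin m), ‖R1 (∑ t, (wal s t : 𝕜) • x t)‖ ^ 2
            + ∑ s : Finset (Fin m), ‖R2 (∑ t, (wal s t : 𝕜) • x t)‖ ^ 2) := by
          rw [← Finset.mul_sum, Finset.sum_add_distrib]
      _ ≤ _ := by linarith
  | smul c R _ h =>
    obtain ⟨C, hC, h⟩ := h
    refine ⟨‖c‖ ^ 2 * C, by positivity, fun m x => ?_⟩
    have e := h m x
    calc _ = ‖c‖ ^ 2 * ∑ s : Finset (Fin m), ‖R (∑ t, (wal s t : 𝕜) • x t)‖ ^ 2 := by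
          rw [Finset.mul_sum]
          refine Finset.sum_congr rfl fun s _ => ?_
          rw [smul_apply, norm_smul, mul_pow]
      _ ≤ ‖c‖ ^ 2 * (C * (2 ^ m * ∑ t, ‖x t‖ ^ 2)) := by gcongr
      _ = _ := by ring

lemma not_mem_closedSpan {𝕜 X Y : Type*} [RCLike 𝕜]
    [NormedAddCommGroup X] [NormedSpace 𝕜 X] [NormedAddCommGroup Y] [NormedSpace 𝕜 Y]
    (p : ℝ) (hp0 : 0 < p) (hp2 : p < 2) (S : X →L[𝕜] Y) (c D : ℝ) (hc : 0 < c) (hD : 0 ≤ D)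
    (x : ∀ m, Finset (Fin m) → X) (hx : ∀ m t, ‖x m t‖ ≤ D)
    (hup : ∀ m s, ‖∑ t, (wal s t : 𝕜) • x m t‖ ≤ D * ((2:ℝ) ^ m) ^ (1 / p))
    (hlo : ∀ m s, c * ((2:ℝ) ^ m) ^ (1 / p) ≤ ‖S (∑ t, (wal s t : 𝕜) • x m t)‖) :
    S ∉ closedSpanHilbertFactorable 𝕜 X Y := by
  intro hS
  have hS' : S ∈ closure (Submodule.span 𝕜 {T : X →L[𝕜] Y | FactorsThroughEllTwo T} : Set (X →L[𝕜] Y)) := hS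
  obtain ⟨R, hR, hd⟩ := Metric.mem_closure_iff.1 hS' (c / (2 * (D + 1))) (by positivity)
  rw [dist_eq_norm] at hd
  obtain ⟨C, hC, hw⟩ := span_walsh R hR
  have key : ∀ m : ℕ, ((2:ℝ) ^ m) ^ (2 / p - 1) ≤ 4 * C * D ^ 2 / c ^ 2 := by
    intro m
    set n : ℝ := (2:ℝ) ^ m with hn
    have hnpos : 0 < n := by positivity
    have h1 : ∀ s, c / 2 * n ^ (1 / p) ≤ ‖R (∑ t, (wal s t : 𝕜) • x m t)‖ := by
      intro s
      set z := ∑ t, (wal s t : 𝕜) • x m t with hz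
      have e1 := hlo m s
      have e2 := hup m s
      have e3 : ‖S z‖ ≤ ‖R z‖ + ‖(S - R) z‖ := by
        have : S z = R z + (S - R) z := by simp
        rw [this]; exact norm_add_le _ _
      have e4 : ‖(S - R) z‖ ≤ c / (2 * (D + 1)) * (D * n ^ (1 / p)) :=
        ((S - R).le_opNorm z).trans (mul_le_mul hd.le e2 (norm_nonneg _) (by positivity))
      have e5 : c / (2 * (D + 1)) * (D * n ^ (1 / p)) ≤ c / 2 * n ^ (1 / p) := by
        have : c / (2 * (D + 1)) * D ≤ c / 2 := by
          rw [div_mul_eq_mul_div, div_le_div_iff₀ (by positivity) (by norm_num)]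
          nlinarith
        calc _ = (c / (2 * (D + 1)) * D) * n ^ (1 / p) := by ring
          _ ≤ _ := by gcongr
      linarith
    have h2 : n * (c / 2 * n ^ (1 / p)) ^ 2 ≤ C * (n * (n * D ^ 2)) := by
      have hcard : ((Finset.univ : Finset (Finset (Fin m))).card : ℝ) = n := by simp [hn]
      calc n * (c / 2 * n ^ (1 / p)) ^ 2 = ∑ s : Finset (Fin m), (c / 2 * n ^ (1 / p)) ^ 2 := by
            rw [Finset.sum_const, nsmul_eq_mul, hcard]
        _ ≤ ∑ s, ‖R (∑ t, (wal s t : 𝕜) • x m t)‖ ^ 2 :=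
            Finset.sum_le_sum fun s _ => pow_le_pow_left₀ (by positivity) (h1 s) 2
        _ ≤ C * (n * ∑ t, ‖x m t‖ ^ 2) := hw m (x m)
        _ ≤ C * (n * ∑ t : Finset (Fin m), D ^ 2) := by
            gcongr with t
            exact hx m t
        _ = _ := by rw [Finset.sum_const, nsmul_eq_mul, hcard]
    have h3 : (n ^ (1 / p)) ^ 2 = n * n ^ (2 / p - 1) := by
      rw [Real.rpow_sub_one hnpos.ne', ← Real.rpow_natCast, ← Real.rpow_mul hnpos.le]
      field_simp
      congr 1
    rw [mul_pow, h3] at h2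
    rw [le_div_iff₀ (by positivity)]
    have h4 : n * (c ^ 2 / 4 * (n * n ^ (2 / p - 1))) ≤ n * (C * (n * D ^ 2)) := by
      nlinarith
    have h5 := le_of_mul_le_mul_left h4 hnpos
    have h6 : n * (c ^ 2 / 4 * n ^ (2 / p - 1)) ≤ n * (C * D ^ 2) := by nlinarith
    have h7 := le_of_mul_le_mul_left h6 hnpos
    linarith
  have ht : Filter.Tendsto (fun m : ℕ => ((2:ℝ) ^ m) ^ (2 / p - 1)) Filter.atTop Filter.atTop :=
    (tendsto_rpow_atTop (by rw [sub_pos, lt_div_iff₀ hp0]; linarith)).comp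
      (tendsto_pow_atTop_atTop_of_one_lt (by norm_num))
  obtain ⟨m, hm⟩ := (ht.eventually_gt_atTop (4 * C * D ^ 2 / c ^ 2)).exists
  exact absurd (key m) (not_le.2 hm)

lemma compl_transport {𝕜 X : Type*} [RCLike 𝕜] [NormedAddCommGroup X] [NormedSpace 𝕜 X]
    (p : ℝ) (hp0 : 0 < p) [Fact (1 ≤ ENNReal.ofReal p)]
    (hcompl : ∃ (P : X →L[𝕜] lp (fun _ : ℕ => 𝕜) (ENNReal.ofReal p))
        (Q : lp (fun _ : ℕ => 𝕜) (ENNReal.ofReal p) →L[𝕜] X), ∀ z, P (Q z) = z)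
    {α : Type*} (e : ℕ ≃ α) :
    ∃ (P : X →L[𝕜] lp (fun _ : α => 𝕜) (ENNReal.ofReal p))
        (Q : lp (fun _ : α => 𝕜) (ENNReal.ofReal p) →L[𝕜] X), ∀ z, P (Q z) = z := by
  obtain ⟨P, Q, h⟩ := hcompl
  have hP : (ENNReal.ofReal p).toReal = p := ENNReal.toReal_ofReal hp0.le
  obtain ⟨R1, hR1⟩ := exists_reindex (𝕜 := 𝕜) (ENNReal.ofReal p) (ENNReal.ofReal p) p p hP hP hp0 le_rfl e
  obtain ⟨R2, hR2⟩ := exists_reindex (𝕜 := 𝕜) (ENNReal.ofReal p) (ENNReal.ofReal p) p p hP hP hp0 le_rfl e.symm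
  refine ⟨R2.comp P, Q.comp R1, fun z => ?_⟩
  simp only [ContinuousLinearMap.comp_apply, h]
  apply lp.ext
  funext a
  rw [hR2, hR1]; simp

lemma exists_walshOp (𝕜 : Type*) [RCLike 𝕜] (p p' : ℝ) (hp1 : 1 < p) (hp2 : p < 2)
    (hc : p.HolderConjugate p') [Fact (1 ≤ ENNReal.ofReal p)] [Fact (1 ≤ ENNReal.ofReal p')] :
    ∃ V : lp (fun _ : (Σ m : ℕ, Finset (Fin m)) => 𝕜) (ENNReal.ofReal p) →L[𝕜]
      lp (fun _ : (Σ m : ℕ, Finset (Fin m)) => 𝕜) (ENNReal.ofReal p'),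
      ∀ x m s, V x ⟨m, s⟩ = ((((2:ℝ) ^ m) ^ (-(1 / p')) : ℝ) : 𝕜) * ∑ t, (wal s t : 𝕜) * x ⟨m, t⟩ := by
  have hp0 : 0 < p := by linarith
  have hp'0 : 0 < p' := hc.symm.pos
  have hP : (ENNReal.ofReal p).toReal = p := ENNReal.toReal_ofReal hp0.le
  have hP' : (ENNReal.ofReal p').toReal = p' := ENNReal.toReal_ofReal hp'0.le
  have hpp' : p ≤ p' := by
    have h1 := hc.inv_add_inv_eq_one
    have h2 : (1 / 2 : ℝ) ≤ p⁻¹ := by rw [← one_div]; exact one_div_le_one_div_of_le hp0 hp2.le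
    have h3 : p'⁻¹ ≤ p⁻¹ := by linarith
    exact (inv_le_inv₀ hp'0 hp0).1 h3
  obtain ⟨C, hC, hB⟩ := block_bound 𝕜 p p' hp1 hp2 hc
  let L : ∀ m : ℕ, (Finset (Fin m) → 𝕜) →ₗ[𝕜] (Finset (Fin m) → 𝕜) := fun m =>
    { toFun := fun x s => ((((2:ℝ) ^ m) ^ (-(1 / p')) : ℝ) : 𝕜) * ∑ t, (wal s t : 𝕜) * x t
      map_add' := fun x y => by
        funext s
        simp [mul_add, Finset.sum_add_distrib]
      map_smul' := fun c x => by
        funext s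
        simp only [Pi.smul_apply, smul_eq_mul, RingHom.id_apply]
        rw [mul_left_comm, Finset.mul_sum (a := c)]
        congr 1
        exact Finset.sum_congr rfl fun t _ => by ring }
  obtain ⟨V, hV⟩ := exists_blockOp (𝕜 := 𝕜) (ENNReal.ofReal p) (ENNReal.ofReal p') p p' hP hP' hp0 hpp'
    L C hC.le (by
      intro m x
      have h := hB m x
      have hn : (0:ℝ) < 2 ^ m := by positivity
      have e : ∀ s, ‖L m x s‖ ^ p' = ((2:ℝ) ^ m)⁻¹ * ‖∑ t, (wal s t : 𝕜) * x t‖ ^ p' := by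
        intro s
        change ‖((((2:ℝ) ^ m) ^ (-(1 / p')) : ℝ) : 𝕜) * ∑ t, (wal s t : 𝕜) * x t‖ ^ p' = _
        rw [norm_mul, RCLike.norm_ofReal, abs_of_pos (by positivity),
          Real.mul_rpow (by positivity) (norm_nonneg _), ← Real.rpow_mul hn.le]
        have : -(1 / p') * p' = -1 := by field_simp
        rw [this, Real.rpow_neg_one]
      simp only [e]
      rw [← Finset.mul_sum, inv_mul_le_iff₀ hn]
      calc _ ≤ _ := h
        _ = _ := by ring)
  exact ⟨V, hV⟩

lemma exists_blockInj (𝕜 : Type*) [RCLike 𝕜] (p : ℝ) (hp0 : 0 < p)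
    (A : ℕ → Type) [∀ k, Fintype (A k)] :
    ∃ ι : ∀ m : ℕ, (A m → 𝕜) →ₗ[𝕜] lp (fun _ : (Σ m : ℕ, A m) => 𝕜) (ENNReal.ofReal p),
      (∀ m c, ‖ι m c‖ ^ p = ∑ t, ‖c t‖ ^ p) ∧ (∀ m c t, ι m c ⟨m, t⟩ = c t) := by
  refine ⟨fun m => blockInj (ENNReal.ofReal p) m, ?_, ?_⟩
  · intro m c
    exact blockInj_norm (ENNReal.ofReal p) p (ENNReal.toReal_ofReal hp0.le) hp0 m c
  · intro m c t
    exact blockInj_apply (ENNReal.ofReal p) m c t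

lemma exists_S (𝕜 : Type*) [RCLike 𝕜] (p p' : ℝ) (q : ℝ≥0∞)
    (hp1 : 1 < p) (hp2 : p < 2) (hc : p.HolderConjugate p') (hq : ENNReal.ofReal p' ≤ q)
    [Fact (1 ≤ ENNReal.ofReal p)] [Fact (1 ≤ ENNReal.ofReal p')] [Fact (1 ≤ q)]
    (X : Type*) [NormedAddCommGroup X] [NormedSpace 𝕜 X]
    (Y : Type*) [NormedAddCommGroup Y] [NormedSpace 𝕜 Y]
    (hcompl : ∃ (P : X →L[𝕜] lp (fun _ : ℕ => 𝕜) (ENNReal.ofReal p))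
        (Q : lp (fun _ : ℕ => 𝕜) (ENNReal.ofReal p) →L[𝕜] X), ∀ z, P (Q z) = z)
    (hcopy : (q ≠ ∞ ∧ ∃ (J : lp (fun _ : ℕ => 𝕜) q →L[𝕜] Y) (c : ℝ),
          0 < c ∧ ∀ z, c * ‖z‖ ≤ ‖J z‖)
        ∨ (q = ∞ ∧ ∃ (J : ZeroAtInftyContinuousMap ℕ 𝕜 →L[𝕜] Y) (c : ℝ),
          0 < c ∧ ∀ z, c * ‖z‖ ≤ ‖J z‖)) (e : ℕ ≃ (Σ m : ℕ, Finset (Fin m))) :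
    ∃ S : X →L[𝕜] Y, FinStrictSing S ∧ RadSmall S ∧ S ∉ closedSpanHilbertFactorable 𝕜 X Y := by
  have hp0 : 0 < p := by linarith
  have hp'0 : 0 < p' := hc.symm.pos
  have hP : (ENNReal.ofReal p).toReal = p := ENNReal.toReal_ofReal hp0.le
  obtain ⟨P, Q, hPQ⟩ := compl_transport p hp0 hcompl e
  obtain ⟨V, hV⟩ := exists_walshOp 𝕜 p p' hp1 hp2 hc
  obtain ⟨W, c, hcpos, hW⟩ := exists_range (𝕜 := 𝕜) p' q hc.symm.lt hq Y hcopy e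
  have hrad : RadSmall V := walsh_radSmall p p' hp1 hp2 hc V hV
  refine ⟨W.comp (V.comp P), fss_comp V P W (fss_of_radSmall p hp1 hp2 V hrad),
    (hrad.comp_right P).comp_left W, ?_⟩
  obtain ⟨ι, hι, hι1⟩ := exists_blockInj 𝕜 p hp0 (fun m => Finset (Fin m))
  have hsum : ∀ m (s : Finset (Fin m)), ∑ t, (wal s t : 𝕜) • Q (ι m (Pi.single t 1))
      = Q (ι m (fun t => (wal s t : 𝕜))) := by
    intro m s
    have : (fun t => (wal s t : 𝕜)) = ∑ t, (wal s t : 𝕜) • (Pi.single t 1 : Finset (Fin m) → 𝕜) := by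
      funext u
      rw [Finset.sum_apply, Finset.sum_eq_single u]
      · rw [Pi.smul_apply, Pi.single_eq_same, smul_eq_mul, mul_one]
      · intro b _ hb
        rw [Pi.smul_apply, Pi.single_eq_of_ne hb.symm, smul_zero]
      · simp
    rw [this, map_sum, map_sum]
    exact Finset.sum_congr rfl fun t _ => by rw [map_smul, map_smul]
  have hn : ∀ m (s : Finset (Fin m)), ‖ι m (fun t => (wal s t : 𝕜))‖ = ((2:ℝ) ^ m) ^ (1 / p) := by
    intro m s
    have h1 := hι m (fun t => (wal s t : 𝕜))
    have h2 : ∀ t, ‖(wal s t : 𝕜)‖ ^ p = 1 := fun t => by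
      rw [RCLike.norm_ofReal, abs_wal, Real.one_rpow]
    simp only [h2] at h1
    have h3 : ‖ι m (fun t => (wal s t : 𝕜))‖ ^ p = (2:ℝ) ^ m := by rw [h1]; simp
    rw [← h3, ← Real.rpow_mul (norm_nonneg _), mul_one_div_cancel hp0.ne', Real.rpow_one]
  refine not_mem_closedSpan p hp0 hp2 _ c ‖Q‖ hcpos (norm_nonneg _)
    (fun m t => Q (ι m (Pi.single t 1))) ?_ ?_ ?_
  · intro m t
    have h1 := hι m (Pi.single t 1)
    rw [Finset.sum_eq_single t] at h1
    · simp only [Pi.single_eq_same, norm_one, Real.one_rpow] at h1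
      have h2 : ‖ι m (Pi.single t 1)‖ = 1 := by
        have h0 := Real.rpow_rpow_inv (norm_nonneg (ι m (Pi.single t 1))) hp0.ne'
        rw [h1, Real.one_rpow] at h0
        exact h0.symm
      have h3 := Q.le_opNorm (ι m (Pi.single t 1))
      rwa [h2, mul_one] at h3
    · intro b _ hb
      rw [Pi.single_eq_of_ne hb, norm_zero, Real.zero_rpow hp0.ne']
    · simp
  · intro m s
    rw [hsum, ← hn m s]
    exact Q.le_opNorm _
  · intro m s
    rw [hsum]
    simp only [ContinuousLinearMap.comp_apply, hPQ]
    refine le_trans ?_ (hW _ ⟨m, s⟩)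
    gcongr
    rw [hV]
    have h1 : ∀ t, (ι m (fun t => (wal s t : 𝕜))) ⟨m, t⟩ = (wal s t : 𝕜) := fun t => hι1 _ _ _
    simp only [h1]
    have h2 : ∑ t : Finset (Fin m), (wal s t : 𝕜) * (wal s t : 𝕜) = (((2:ℝ) ^ m : ℝ) : 𝕜) := by
      have := wal_orth s s
      rw [if_pos rfl] at this
      rw [← this]; push_cast; rfl
    rw [h2, ← RCLike.ofReal_mul, RCLike.norm_ofReal, abs_of_pos (by positivity)]
    have hpos : (0:ℝ) < 2 ^ m := by positivity
    nth_rw 3 [← Real.rpow_one ((2:ℝ) ^ m)]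
    rw [← Real.rpow_add hpos]
    have : 1 / p = -(1 / p') + 1 := by
      have := hc.inv_add_inv_eq_one
      rw [one_div, one_div]; linarith
    rw [this]

lemma dual_rad_bound (𝕜 : Type*) [RCLike 𝕜] (p p' : ℝ) (hc : p.HolderConjugate p') :
    ∃ C : ℝ, 0 < C ∧ ∀ (m : ℕ) (x : Finset (Fin m) → 𝕜),
      ∑ i, ‖∑ t, (rad i t : 𝕜) * x t‖ ^ 2 ≤ C * ((2:ℝ) ^ m) ^ (2 / p') * (∑ t, ‖x t‖ ^ p) ^ (2 / p) := by
  have hp0 : 0 < p := hc.pos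
  have hp'0 : 0 < p' := hc.symm.pos
  obtain ⟨C, hC, hK⟩ := khinchin_upper 𝕜 p' hp'0
  refine ⟨(C ^ (1 / p')) ^ 2, by positivity, fun m x => ?_⟩
  set y : Fin m → 𝕜 := fun i => ∑ t, (rad i t : 𝕜) * x t with hy
  set S : ℝ := ∑ i, ‖y i‖ ^ 2 with hS
  have hS0 : 0 ≤ S := Finset.sum_nonneg fun i _ => by positivity
  set N : ℝ := (∑ t, ‖x t‖ ^ p) ^ (1 / p) with hN
  have hX0 : 0 ≤ ∑ t, ‖x t‖ ^ p := Finset.sum_nonneg fun i _ => by positivity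
  have hN0 : 0 ≤ N := Real.rpow_nonneg hX0 _
  have h1 : ((S : ℝ) : 𝕜) = ∑ t, x t * ∑ i, (rad i t : 𝕜) * (starRingEnd 𝕜) (y i) := by
    rw [hS]
    push_cast
    calc ∑ i, ((‖y i‖ : ℝ) : 𝕜) ^ 2 = ∑ i, (starRingEnd 𝕜) (y i) * ∑ t, (rad i t : 𝕜) * x t :=
          Finset.sum_congr rfl fun i _ => (RCLike.conj_mul (y i)).symm
      _ = ∑ i, ∑ t, (starRingEnd 𝕜) (y i) * ((rad i t : 𝕜) * x t) := by
          simp only [Finset.mul_sum]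
      _ = ∑ t, ∑ i, (starRingEnd 𝕜) (y i) * ((rad i t : 𝕜) * x t) := Finset.sum_comm
      _ = _ := by
          refine Finset.sum_congr rfl fun t _ => ?_
          rw [Finset.mul_sum]
          exact Finset.sum_congr rfl fun i _ => by ring
  have h2 : S ≤ ∑ t, ‖x t‖ * ‖∑ i, (rad i t : 𝕜) * (starRingEnd 𝕜) (y i)‖ := by
    calc S = ‖((S : ℝ) : 𝕜)‖ := by rw [RCLike.norm_ofReal, abs_of_nonneg hS0]
      _ ≤ _ := by
        rw [h1]
        refine (norm_sum_le _ _).trans (Finset.sum_le_sum fun t _ => ?_)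
        rw [norm_mul]
  have h3 := Real.inner_le_Lp_mul_Lq_of_nonneg Finset.univ hc
    (f := fun t => ‖x t‖) (g := fun t => ‖∑ i, (rad i t : 𝕜) * (starRingEnd 𝕜) (y i)‖)
    (fun _ _ => norm_nonneg _) (fun _ _ => norm_nonneg _)
  have h4 := hK m (fun i => (starRingEnd 𝕜) (y i))
  simp only [RCLike.norm_conj] at h4
  have h5 : (∑ t, ‖∑ i, (rad i t : 𝕜) * (starRingEnd 𝕜) (y i)‖ ^ p') ^ (1 / p')
      ≤ C ^ (1 / p') * ((2:ℝ) ^ m) ^ (1 / p') * Real.sqrt S := by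
    calc _ ≤ (C * 2 ^ m * S ^ (p' / 2)) ^ (1 / p') :=
          Real.rpow_le_rpow (Finset.sum_nonneg fun i _ => by positivity) h4 (by positivity)
      _ = _ := by
          rw [Real.mul_rpow (by positivity) (by positivity), Real.mul_rpow hC.le (by positivity),
            ← Real.rpow_mul hS0, Real.sqrt_eq_rpow]
          congr 2
          field_simp
  have h6 : Real.sqrt S * Real.sqrt S ≤ (N * (C ^ (1 / p') * ((2:ℝ) ^ m) ^ (1 / p'))) * Real.sqrt S := by
    rw [Real.mul_self_sqrt hS0]
    calc S ≤ _ := h2.trans h3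
      _ ≤ N * (C ^ (1 / p') * ((2:ℝ) ^ m) ^ (1 / p') * Real.sqrt S) :=
          mul_le_mul_of_nonneg_left h5 hN0
      _ = _ := by ring
  have h7 : Real.sqrt S ≤ N * (C ^ (1 / p') * ((2:ℝ) ^ m) ^ (1 / p')) := by
    rcases (Real.sqrt_nonneg S).eq_or_lt with h | h
    · rw [← h]; positivity
    · exact le_of_mul_le_mul_right h6 h
  have h8 : S ≤ (N * (C ^ (1 / p') * ((2:ℝ) ^ m) ^ (1 / p'))) ^ 2 := by
    rw [← Real.sq_sqrt hS0]; exact pow_le_pow_left₀ (Real.sqrt_nonneg _) h7 2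
  have e1 : N ^ 2 = (∑ t, ‖x t‖ ^ p) ^ (2 / p) := by
    rw [hN, ← Real.rpow_natCast, ← Real.rpow_mul hX0]; congr 1; push_cast; ring
  have e2 : (((2:ℝ) ^ m) ^ (1 / p')) ^ 2 = ((2:ℝ) ^ m) ^ (2 / p') := by
    rw [← Real.rpow_natCast, ← Real.rpow_mul (by positivity)]; congr 1; push_cast; ring
  calc S ≤ _ := h8
    _ = (C ^ (1 / p')) ^ 2 * (((2:ℝ) ^ m) ^ (1 / p')) ^ 2 * N ^ 2 := by ring
    _ = _ := by rw [e1, e2]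

lemma exists_alpha (𝕜 : Type*) [RCLike 𝕜] (p p' : ℝ) (hp2 : p < 2) (hc : p.HolderConjugate p')
    [Fact (1 ≤ ENNReal.ofReal p)] :
    ∃ A : lp (fun _ : (Σ m : ℕ, Finset (Fin m)) => 𝕜) (ENNReal.ofReal p) →L[𝕜]
      lp (fun _ : (Σ m : ℕ, Fin m) => 𝕜) 2,
      ∀ x m i, A x ⟨m, i⟩ = ((((2:ℝ) ^ m) ^ (-(1 / p')) : ℝ) : 𝕜) * ∑ t, (rad i t : 𝕜) * x ⟨m, t⟩ := by
  have hp0 : 0 < p := hc.pos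
  have hp'0 : 0 < p' := hc.symm.pos
  have hP : (ENNReal.ofReal p).toReal = p := ENNReal.toReal_ofReal hp0.le
  obtain ⟨C, hC, hB⟩ := dual_rad_bound 𝕜 p p' hc
  let L : ∀ m : ℕ, (Finset (Fin m) → 𝕜) →ₗ[𝕜] (Fin m → 𝕜) := fun m =>
    { toFun := fun x i => ((((2:ℝ) ^ m) ^ (-(1 / p')) : ℝ) : 𝕜) * ∑ t, (rad i t : 𝕜) * x t
      map_add' := fun x y => by
        funext s
        simp [mul_add, Finset.sum_add_distrib]
      map_smul' := fun c x => by
        funext s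
        simp only [Pi.smul_apply, smul_eq_mul, RingHom.id_apply]
        rw [mul_left_comm, Finset.mul_sum (a := c)]
        congr 1
        exact Finset.sum_congr rfl fun t _ => by ring }
  obtain ⟨V, hV⟩ := exists_blockOp (𝕜 := 𝕜) (ENNReal.ofReal p) 2 p 2 hP (by simp) hp0 hp2.le
    L C hC.le (by
      intro m x
      have h := hB m x
      have hn : (0:ℝ) < 2 ^ m := by positivity
      have e : ∀ i, ‖L m x i‖ ^ (2:ℝ) = (((2:ℝ) ^ m) ^ (2 / p'))⁻¹ * ‖∑ t, (rad i t : 𝕜) * x t‖ ^ 2 := by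
        intro s
        change ‖((((2:ℝ) ^ m) ^ (-(1 / p')) : ℝ) : 𝕜) * ∑ t, (rad s t : 𝕜) * x t‖ ^ (2:ℝ) = _
        rw [norm_mul, RCLike.norm_ofReal, abs_of_pos (by positivity),
          Real.mul_rpow (by positivity) (norm_nonneg _), ← Real.rpow_mul hn.le]
        have : -(1 / p') * 2 = -(2 / p') := by field_simp
        rw [this, Real.rpow_neg hn.le, Real.rpow_two]
      simp only [e]
      rw [← Finset.mul_sum, inv_mul_le_iff₀ (by positivity)]
      calc _ ≤ _ := h
        _ = _ := by ring)
  exact ⟨V, hV⟩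

lemma exists_beta_lq (𝕜 : Type*) [RCLike 𝕜] (q : ℝ≥0∞) [Fact (1 ≤ q)] (hq : q ≠ ∞)
    (hq2 : 2 ≤ q.toReal)
    (Y : Type*) [NormedAddCommGroup Y] [NormedSpace 𝕜 Y]
    (J : lp (fun _ : ℕ => 𝕜) q →L[𝕜] Y) (c : ℝ) (hc : 0 < c) (hJ : ∀ z, c * ‖z‖ ≤ ‖J z‖)
    (e : ℕ ≃ (Σ m : ℕ, Finset (Fin m))) :
    ∃ B : lp (fun _ : (Σ m : ℕ, Fin m) => 𝕜) 2 →L[𝕜] Y, ∃ c : ℝ, 0 < c ∧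
      ∀ z m, c * Real.sqrt (∑ i, ‖z ⟨m, i⟩‖ ^ 2) ≤ ‖B z‖ := by
  set r := q.toReal with hr
  have hr0 : 0 < r := by linarith
  obtain ⟨C, hC, hB⟩ := khinchin_upper 𝕜 r hr0
  let L : ∀ m : ℕ, (Fin m → 𝕜) →ₗ[𝕜] (Finset (Fin m) → 𝕜) := fun m =>
    { toFun := fun x t => ((((2:ℝ) ^ m) ^ (-(1 / r)) : ℝ) : 𝕜) * ∑ i, (rad i t : 𝕜) * x i
      map_add' := fun x y => by
        funext s
        simp [mul_add, Finset.sum_add_distrib]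
      map_smul' := fun c x => by
        funext s
        simp only [Pi.smul_apply, smul_eq_mul, RingHom.id_apply]
        rw [mul_left_comm, Finset.mul_sum (a := c)]
        congr 1
        exact Finset.sum_congr rfl fun t _ => by ring }
  have hL : ∀ m x t, ‖L m x t‖ ^ r = ((2:ℝ) ^ m)⁻¹ * ‖∑ i, (rad i t : 𝕜) * x i‖ ^ r := by
    intro m x t
    have hn : (0:ℝ) < 2 ^ m := by positivity
    change ‖((((2:ℝ) ^ m) ^ (-(1 / r)) : ℝ) : 𝕜) * ∑ i, (rad i t : 𝕜) * x i‖ ^ r = _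
    rw [norm_mul, RCLike.norm_ofReal, abs_of_pos (by positivity),
      Real.mul_rpow (by positivity) (norm_nonneg _), ← Real.rpow_mul hn.le]
    have : -(1 / r) * r = -1 := by field_simp
    rw [this, Real.rpow_neg_one]
  obtain ⟨V, hV⟩ := exists_blockOp (𝕜 := 𝕜) 2 q 2 r (by simp) hr.symm (by norm_num) hq2
    L C hC.le (by
      intro m x
      have h := hB m x
      have hn : (0:ℝ) < 2 ^ m := by positivity
      simp only [hL]
      rw [← Finset.mul_sum, inv_mul_le_iff₀ (by positivity)]
      simp only [Real.rpow_two]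
      calc _ ≤ _ := h
        _ = _ := by ring)
  obtain ⟨R, hR⟩ := exists_reindex (𝕜 := 𝕜) q q r r hr.symm hr.symm hr0 le_rfl e
  refine ⟨J.comp (R.comp V), c, hc, fun z m => ?_⟩
  refine le_trans (mul_le_mul_of_nonneg_left ?_ hc.le) (hJ _)
  have hn : (0:ℝ) < 2 ^ m := by positivity
  set a : Fin m → 𝕜 := fun i => z ⟨m, i⟩ with ha
  have hA0 : 0 ≤ ∑ i, ‖a i‖ ^ 2 := Finset.sum_nonneg fun i _ => by positivity
  have h1 := lp.sum_rpow_le_norm_rpow (by rw [← hr]; exact hr0) (R (V z))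
    (Finset.univ.map ((Function.Embedding.sigmaMk m).trans e.symm.toEmbedding))
  rw [Finset.sum_map, ← hr] at h1
  have h2 : ∀ t : Finset (Fin m), R (V z) (((Function.Embedding.sigmaMk m).trans e.symm.toEmbedding) t)
      = L m a t := by
    intro t
    rw [hR]
    simp only [Function.Embedding.trans_apply, Equiv.coe_toEmbedding, Equiv.apply_symm_apply]
    exact hV z m t
  simp only [h2, hL] at h1
  have h3 := Real.rpow_sum_le_const_mul_sum_rpow (Finset.univ : Finset (Finset (Fin m)))
    (fun t => ‖∑ i, (rad i t : 𝕜) * a i‖ ^ 2) (show 1 ≤ r / 2 by linarith)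
  have e1 : ∀ t : Finset (Fin m), |‖∑ i, (rad i t : 𝕜) * a i‖ ^ 2| = ‖∑ i, (rad i t : 𝕜) * a i‖ ^ 2 :=
    fun t => abs_of_nonneg (by positivity)
  have e2 : ∀ t : Finset (Fin m), (‖∑ i, (rad i t : 𝕜) * a i‖ ^ 2) ^ (r / 2)
      = ‖∑ i, (rad i t : 𝕜) * a i‖ ^ r := fun t => by
    rw [← Real.rpow_natCast, ← Real.rpow_mul (norm_nonneg _)]; congr 1; push_cast; ring
  have e3 := rad_parseval (𝕜 := 𝕜) a
  simp only [smul_eq_mul] at e3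
  have hcard : ((Finset.univ : Finset (Finset (Fin m))).card : ℝ) = 2 ^ m := by simp
  simp only [e1, e2] at h3
  rw [e3, hcard, Real.mul_rpow hn.le hA0, Real.rpow_sub_one hn.ne'] at h3
  have h4 : (∑ i, ‖a i‖ ^ 2) ^ (r / 2) ≤ ‖R (V z)‖ ^ r := by
    refine le_trans ?_ h1
    rw [← Finset.mul_sum]
    have hpos : 0 < ((2:ℝ) ^ m) ^ (r / 2) := by positivity
    refine le_of_mul_le_mul_left ?_ hpos
    calc _ ≤ _ := h3
      _ = _ := by ring
  have h5 : (Real.sqrt (∑ i, ‖a i‖ ^ 2)) ^ r ≤ ‖R (V z)‖ ^ r := by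
    rw [Real.sqrt_eq_rpow, ← Real.rpow_mul hA0]
    convert h4 using 2; ring
  exact (Real.rpow_le_rpow_iff (Real.sqrt_nonneg _) (norm_nonneg _) hr0).1 h5

lemma exists_net (𝕜 : Type*) [RCLike 𝕜] (m : ℕ) :
    ∃ N : ℕ, 0 < N ∧ ∃ b : Fin N → EuclideanSpace 𝕜 (Fin m), (∀ j, ‖b j‖ ≤ 1) ∧
      ∀ a : EuclideanSpace 𝕜 (Fin m), ∃ j, 1 / 2 * ‖a‖ ≤ ‖inner 𝕜 (b j) a‖ := by
  have hprop : ProperSpace (EuclideanSpace 𝕜 (Fin m)) := FiniteDimensional.proper 𝕜 _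
  obtain ⟨t, ht, hfin, hcov⟩ := (isCompact_closedBall (0 : EuclideanSpace 𝕜 (Fin m)) 1).finite_cover_balls
    (show (0:ℝ) < 1 / 2 by norm_num)
  have hfin' : Fintype t := hfin.fintype
  let f := (Fintype.equivFin t).symm
  have hne : t.Nonempty := by
    have h0 : (0 : EuclideanSpace 𝕜 (Fin m)) ∈ Metric.closedBall (0 : EuclideanSpace 𝕜 (Fin m)) 1 := by simp
    have := hcov h0
    simp only [Set.mem_iUnion] at this
    obtain ⟨b, hb, _⟩ := this
    exact ⟨b, hb⟩
  refine ⟨Fintype.card t, Fintype.card_pos_iff.2 hne.to_subtype, fun j => f j, fun j => ?_, fun a => ?_⟩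
  · simpa using ht (f j).2
  · rcases (norm_nonneg a).eq_or_lt with h | h
    · rw [← h, mul_zero]
      obtain ⟨b, hb⟩ := hne
      exact ⟨f.symm ⟨b, hb⟩, norm_nonneg _⟩
    · set u : EuclideanSpace 𝕜 (Fin m) := ((‖a‖⁻¹ : ℝ) : 𝕜) • a with hu
      have hun : ‖u‖ = 1 := by
        rw [hu, norm_smul, RCLike.norm_ofReal, abs_of_pos (by positivity), inv_mul_cancel₀ h.ne']
      have hau : a = ((‖a‖ : ℝ) : 𝕜) • u := by
        rw [hu, smul_smul, ← RCLike.ofReal_mul, mul_inv_cancel₀ h.ne', RCLike.ofReal_one, one_smul]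
      have := hcov (show u ∈ Metric.closedBall 0 1 by simp [hun])
      simp only [Set.mem_iUnion] at this
      obtain ⟨b, hb, hub⟩ := this
      rw [Metric.mem_ball, dist_eq_norm] at hub
      refine ⟨f.symm ⟨b, hb⟩, ?_⟩
      simp only [Equiv.apply_symm_apply]
      have h1 : inner 𝕜 u u = inner 𝕜 b u + inner 𝕜 (u - b) u := by
        rw [inner_sub_left]; ring
      have h2 : ‖inner 𝕜 u u‖ = 1 := by
        rw [inner_self_eq_norm_sq_to_K, hun]; simp
      have h3 : ‖inner 𝕜 (u - b) u‖ ≤ 1 / 2 := by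
        refine (norm_inner_le_norm _ _).trans ?_
        rw [hun, mul_one]; exact hub.le
      have h4 : 1 / 2 ≤ ‖inner 𝕜 b u‖ := by
        have := norm_add_le (inner 𝕜 b u) (inner 𝕜 (u - b) u)
        rw [← h1, h2] at this
        linarith
      have h5 : ‖inner 𝕜 b a‖ = ‖a‖ * ‖inner 𝕜 b u‖ := by
        conv_lhs => rw [hau]
        rw [inner_smul_right, norm_mul, RCLike.norm_ofReal, abs_of_pos h]
      change 1 / 2 * ‖a‖ ≤ ‖inner 𝕜 b a‖
      rw [h5]
      nlinarith

lemma exists_beta_c0 (𝕜 : Type*) [RCLike 𝕜]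
    (Y : Type*) [NormedAddCommGroup Y] [NormedSpace 𝕜 Y]
    (J : ZeroAtInftyContinuousMap ℕ 𝕜 →L[𝕜] Y) (c : ℝ) (hc : 0 < c) (hJ : ∀ z, c * ‖z‖ ≤ ‖J z‖) :
    ∃ B : lp (fun _ : (Σ m : ℕ, Fin m) => 𝕜) 2 →L[𝕜] Y, ∃ c : ℝ, 0 < c ∧
      ∀ z m, c * Real.sqrt (∑ i, ‖z ⟨m, i⟩‖ ^ 2) ≤ ‖B z‖ := by
  choose N hN b hb1 hb2 using exists_net 𝕜
  have hinf : Infinite (Σ m, Fin (N m)) :=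
    Infinite.of_injective (fun m => (⟨m, ⟨0, hN m⟩⟩ : Σ m, Fin (N m))) fun x y h => congrArg Sigma.fst h
  obtain ⟨hden⟩ := nonempty_denumerable (Σ m, Fin (N m))
  let e : (Σ m, Fin (N m)) ≃ ℕ := Denumerable.eqv _
  let pr : lp (fun _ : (Σ m : ℕ, Fin m) => 𝕜) 2 → ∀ m, EuclideanSpace 𝕜 (Fin m) :=
    fun z m => WithLp.toLp 2 fun i => z ⟨m, i⟩
  have hpr : ∀ z m, ‖pr z m‖ = Real.sqrt (∑ i, ‖z ⟨m, i⟩‖ ^ 2) := fun z m => EuclideanSpace.norm_eq _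
  let L : lp (fun _ : (Σ m : ℕ, Fin m) => 𝕜) 2 →ₗ[𝕜] (ℕ → 𝕜) :=
    { toFun := fun z n => inner 𝕜 (b (e.symm n).1 (e.symm n).2) (pr z (e.symm n).1)
      map_add' := fun x y => by
        funext n
        have : pr (x + y) (e.symm n).1 = pr x (e.symm n).1 + pr y (e.symm n).1 := rfl
        rw [this, inner_add_right]; rfl
      map_smul' := fun c x => by
        funext n
        have : pr (c • x) (e.symm n).1 = c • pr x (e.symm n).1 := rfl
        rw [this, inner_smul_right]; rfl }
  have hLle : ∀ z n, ‖L z n‖ ≤ ‖pr z (e.symm n).1‖ := by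
    intro z n
    refine (norm_inner_le_norm (𝕜 := 𝕜) (b (e.symm n).1 (e.symm n).2) (pr z (e.symm n).1)).trans ?_
    exact mul_le_of_le_one_left (norm_nonneg _) (hb1 _ _)
  have hsum : ∀ z : lp (fun _ : (Σ m : ℕ, Fin m) => 𝕜) 2, Summable fun a => ‖z a‖ ^ 2 := by
    intro z
    have := (lp.memℓp z).summable (by norm_num)
    simpa using this
  have hle : ∀ z m, ‖pr z m‖ ≤ ‖z‖ := by
    intro z m
    rw [hpr]
    have h1 := lp.sum_rpow_le_norm_rpow (by norm_num) z (Finset.univ.map (Function.Embedding.sigmaMk m))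
    rw [Finset.sum_map] at h1
    simp only [ENNReal.toReal_ofNat, Real.rpow_two] at h1
    exact Real.sqrt_le_iff.2 ⟨norm_nonneg _, h1⟩
  obtain ⟨T, hT⟩ := c0_mk L 1 (fun z n => by rw [one_mul]; exact (hLle z n).trans (hle z _)) (by
    intro z
    have h1 := (hsum z).sigma.tendsto_cofinite_zero
    have h2 : Filter.Tendsto (fun m => ‖pr z m‖) Filter.cofinite (nhds 0) := by
      have h3 := (Real.continuous_sqrt.tendsto 0).comp h1
      rw [Real.sqrt_zero] at h3
      refine h3.congr fun m => ?_
      rw [hpr, Function.comp_apply, tsum_fintype]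
    have h4 : Filter.Tendsto (Sigma.fst : (Σ m, Fin (N m)) → ℕ) Filter.cofinite Filter.cofinite := by
      refine Filter.Tendsto.cofinite_of_finite_preimage_singleton fun m => ?_
      refine (Set.finite_range (fun j : Fin (N m) => (⟨m, j⟩ : Σ m, Fin (N m)))).subset ?_
      rintro ⟨k, j⟩ hk
      have hk : k = m := hk
      subst hk
      exact ⟨j, rfl⟩
    have h5 := (h2.comp h4).comp e.symm.injective.tendsto_cofinite
    exact squeeze_zero_norm (fun n => hLle z n) h5)
  refine ⟨J.comp T, c / 2, by positivity, fun z m => ?_⟩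
  refine le_trans ?_ (hJ _)
  obtain ⟨j, hj⟩ := hb2 m (pr z m)
  have h1 := c0_apply_le (T z) (e ⟨m, j⟩)
  have h2 : T z (e ⟨m, j⟩) = inner 𝕜 (b m j) (pr z m) := by
    rw [hT]
    change inner 𝕜 (b (e.symm (e ⟨m, j⟩)).1 (e.symm (e ⟨m, j⟩)).2) (pr z (e.symm (e ⟨m, j⟩)).1) = _
    rw [e.symm_apply_apply]
  rw [h2] at h1
  rw [← hpr]
  calc c / 2 * ‖pr z m‖ = c * (1 / 2 * ‖pr z m‖) := by ring
    _ ≤ c * ‖T z‖ := mul_le_mul_of_nonneg_left (hj.trans h1) hc.le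

lemma exists_T (𝕜 : Type*) [RCLike 𝕜] (p p' : ℝ) (q : ℝ≥0∞)
    (hp2 : p < 2) (hc : p.HolderConjugate p') (hq : ENNReal.ofReal p' ≤ q)
    [Fact (1 ≤ ENNReal.ofReal p)] [Fact (1 ≤ q)]
    (X : Type*) [NormedAddCommGroup X] [NormedSpace 𝕜 X]
    (Y : Type*) [NormedAddCommGroup Y] [NormedSpace 𝕜 Y]
    (hcompl : ∃ (P : X →L[𝕜] lp (fun _ : ℕ => 𝕜) (ENNReal.ofReal p))
        (Q : lp (fun _ : ℕ => 𝕜) (ENNReal.ofReal p) →L[𝕜] X), ∀ z, P (Q z) = z)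
    (hcopy : (q ≠ ∞ ∧ ∃ (J : lp (fun _ : ℕ => 𝕜) q →L[𝕜] Y) (c : ℝ),
          0 < c ∧ ∀ z, c * ‖z‖ ≤ ‖J z‖)
        ∨ (q = ∞ ∧ ∃ (J : ZeroAtInftyContinuousMap ℕ 𝕜 →L[𝕜] Y) (c : ℝ),
          0 < c ∧ ∀ z, c * ‖z‖ ≤ ‖J z‖))
    (e : ℕ ≃ (Σ m : ℕ, Finset (Fin m))) (e' : ℕ ≃ (Σ m : ℕ, Fin m)) :
    ∃ T : X →L[𝕜] Y, FactorsThroughEllTwo T ∧ ∃ c D : ℝ, 0 < c ∧ 0 < D ∧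
      ∀ k : ℕ, ∃ Φ : (Fin k → 𝕜) →ₗ[𝕜] X, ∀ a,
        ‖Φ a‖ ≤ D * Real.sqrt (∑ i, ‖a i‖ ^ 2) ∧ c * Real.sqrt (∑ i, ‖a i‖ ^ 2) ≤ ‖T (Φ a)‖ := by
  have hp0 : 0 < p := hc.pos
  have hp'0 : 0 < p' := hc.symm.pos
  have hinv := hc.inv_add_inv_eq_one
  have hp'2 : 2 ≤ p' := by
    have h2 : (1 / 2 : ℝ) ≤ p⁻¹ := by rw [← one_div]; exact one_div_le_one_div_of_le hp0 hp2.le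
    have h3 : p'⁻¹ ≤ 2⁻¹ := by linarith
    exact (inv_le_inv₀ hp'0 (by norm_num)).1 h3
  obtain ⟨P, Q, hPQ⟩ := compl_transport p hp0 hcompl e
  obtain ⟨A, hA⟩ := exists_alpha 𝕜 p p' hp2 hc
  have hrange : ∃ B : lp (fun _ : (Σ m : ℕ, Fin m) => 𝕜) 2 →L[𝕜] Y, ∃ c : ℝ, 0 < c ∧
      ∀ z m, c * Real.sqrt (∑ i, ‖z ⟨m, i⟩‖ ^ 2) ≤ ‖B z‖ := by
    rcases hcopy with ⟨hqt, J, c, hcp, hJ⟩ | ⟨hqt, J, c, hcp, hJ⟩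
    · refine exists_beta_lq 𝕜 q hqt ?_ Y J c hcp hJ e
      have := ENNReal.toReal_mono hqt hq
      rw [ENNReal.toReal_ofReal hp'0.le] at this
      linarith
    · exact exists_beta_c0 𝕜 Y J c hcp hJ
  obtain ⟨B, c, hcp, hB⟩ := hrange
  obtain ⟨R1, hR1⟩ := exists_reindex (𝕜 := 𝕜) 2 2 2 2 (by simp) (by simp) (by norm_num) le_rfl e'
  obtain ⟨R2, hR2⟩ := exists_reindex (𝕜 := 𝕜) 2 2 2 2 (by simp) (by simp) (by norm_num) le_rfl e'.symm
  have hR : ∀ z, R2 (R1 z) = z := by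
    intro z
    apply lp.ext
    funext a
    rw [hR2, hR1]; simp
  obtain ⟨ι, hι, hι1⟩ := exists_blockInj 𝕜 p hp0 (fun m => Finset (Fin m))
  obtain ⟨C, hC, hK⟩ := khinchin_upper 𝕜 p hp0
  refine ⟨(B.comp R2).comp (R1.comp (A.comp P)), ⟨R1.comp (A.comp P), B.comp R2, rfl⟩, c,
    (‖Q‖ + 1) * C ^ (1 / p), hcp, by positivity, fun k => ?_⟩
  let ρ : (Fin k → 𝕜) →ₗ[𝕜] (Finset (Fin k) → 𝕜) :=
    { toFun := fun a t => ((((2:ℝ) ^ k) ^ (-(1 / p)) : ℝ) : 𝕜) * ∑ i, (rad i t : 𝕜) * a i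
      map_add' := fun x y => by
        funext s
        simp [mul_add, Finset.sum_add_distrib]
      map_smul' := fun c x => by
        funext s
        simp only [Pi.smul_apply, smul_eq_mul, RingHom.id_apply]
        rw [mul_left_comm, Finset.mul_sum (a := c)]
        congr 1
        exact Finset.sum_congr rfl fun t _ => by ring }
  have hρ : ∀ a t, ρ a t = ((((2:ℝ) ^ k) ^ (-(1 / p)) : ℝ) : 𝕜) * ∑ i, (rad i t : 𝕜) * a i :=
    fun _ _ => rfl
  clear_value ρ
  have hn : (0:ℝ) < 2 ^ k := by positivity
  refine ⟨(Q : _ →ₗ[𝕜] X) ∘ₗ ι k ∘ₗ ρ, fun a => ⟨?_, ?_⟩⟩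
  · have hA0 : 0 ≤ ∑ i, ‖a i‖ ^ 2 := Finset.sum_nonneg fun i _ => by positivity
    have h1 : ‖ι k (ρ a)‖ ^ p ≤ C * (∑ i, ‖a i‖ ^ 2) ^ (p / 2) := by
      rw [hι]
      have e1 : ∀ t, ‖ρ a t‖ ^ p = ((2:ℝ) ^ k)⁻¹ * ‖∑ i, (rad i t : 𝕜) * a i‖ ^ p := by
        intro t
        rw [hρ, norm_mul, RCLike.norm_ofReal, abs_of_pos (by positivity),
          Real.mul_rpow (by positivity) (norm_nonneg _), ← Real.rpow_mul hn.le]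
        have : -(1 / p) * p = -1 := by field_simp
        rw [this, Real.rpow_neg_one]
      simp only [e1]
      rw [← Finset.mul_sum, inv_mul_le_iff₀ hn]
      calc _ ≤ _ := hK k a
        _ = _ := by ring
    have h2 : ‖ι k (ρ a)‖ ≤ C ^ (1 / p) * Real.sqrt (∑ i, ‖a i‖ ^ 2) := by
      have h3 := Real.rpow_le_rpow (by positivity) h1 (show 0 ≤ 1 / p by positivity)
      rw [← Real.rpow_mul (norm_nonneg _), mul_one_div_cancel hp0.ne', Real.rpow_one,
        Real.mul_rpow hC.le (by positivity), ← Real.rpow_mul hA0] at h3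
      rw [Real.sqrt_eq_rpow]
      convert h3 using 3
      field_simp
    change ‖Q (ι k (ρ a))‖ ≤ _
    calc _ ≤ ‖Q‖ * ‖ι k (ρ a)‖ := Q.le_opNorm _
      _ ≤ (‖Q‖ + 1) * (C ^ (1 / p) * Real.sqrt (∑ i, ‖a i‖ ^ 2)) := by
          gcongr; linarith
      _ = _ := by ring
  · change _ ≤ ‖B (R2 (R1 (A (P (Q (ι k (ρ a)))))))‖
    rw [hPQ, hR]
    refine le_trans (le_of_eq ?_) (hB _ k)
    congr 3
    funext i
    congr 2
    rw [hA]
    simp only [hι1, hρ]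
    have h1 : ∑ t, (rad i t : 𝕜) * (((((2:ℝ) ^ k) ^ (-(1 / p)) : ℝ) : 𝕜) * ∑ j, (rad j t : 𝕜) * a j)
        = ((((2:ℝ) ^ k) ^ (-(1 / p)) : ℝ) : 𝕜) * ∑ j, (((∑ t, rad i t * rad j t : ℝ)) : 𝕜) * a j := by
      rw [Finset.mul_sum]
      simp only [Finset.mul_sum]
      rw [Finset.sum_comm]
      refine Finset.sum_congr rfl fun j _ => ?_
      rw [RCLike.ofReal_sum, Finset.sum_mul, Finset.mul_sum]
      refine Finset.sum_congr rfl fun t _ => ?_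
      push_cast; ring
    rw [h1]
    simp only [rad_orth]
    rw [Finset.sum_eq_single i]
    · rw [if_pos rfl, ← mul_assoc, ← mul_assoc, ← RCLike.ofReal_mul, ← RCLike.ofReal_mul,
        ← Real.rpow_add hn]
      have : -(1 / p') + -(1 / p) = -1 := by rw [one_div, one_div]; linarith
      rw [this, Real.rpow_neg_one, inv_mul_cancel₀ hn.ne', RCLike.ofReal_one, one_mul]
    · intro j _ hj
      rw [if_neg (Ne.symm hj)]; simp
    · simp

lemma not_fss_of {𝕜 X Y : Type*} [RCLike 𝕜]
    [NormedAddCommGroup X] [NormedSpace 𝕜 X] [NormedAddCommGroup Y] [NormedSpace 𝕜 Y]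
    (T : X →L[𝕜] Y) (c D : ℝ) (hc : 0 < c) (hD : 0 < D)
    (h : ∀ k : ℕ, ∃ Φ : (Fin k → 𝕜) →ₗ[𝕜] X, ∀ a,
        ‖Φ a‖ ≤ D * Real.sqrt (∑ i, ‖a i‖ ^ 2) ∧ c * Real.sqrt (∑ i, ‖a i‖ ^ 2) ≤ ‖T (Φ a)‖) :
    ¬ FinStrictSing T := by
  intro hT
  obtain ⟨n, hn⟩ := hT (c / D) (by positivity)
  obtain ⟨Φ, hΦ⟩ := h n
  have hinj : Function.Injective Φ := by
    rw [injective_iff_map_eq_zero]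
    intro a ha
    have h1 := (hΦ a).2
    rw [ha, map_zero, norm_zero] at h1
    have h2 : Real.sqrt (∑ i, ‖a i‖ ^ 2) ≤ 0 := by
      by_contra! hcon
      have := mul_pos hc hcon
      linarith
    have h3 : ∑ i, ‖a i‖ ^ 2 ≤ 0 := Real.sqrt_eq_zero'.1 (le_antisymm h2 (Real.sqrt_nonneg _))
    have h4 : ∑ i, ‖a i‖ ^ 2 = 0 := le_antisymm h3 (Finset.sum_nonneg fun i _ => by positivity)
    rw [Finset.sum_eq_zero_iff_of_nonneg (fun i _ => by positivity)] at h4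
    funext i
    simpa using h4 i (Finset.mem_univ i)
  obtain ⟨x, ⟨a, rfl⟩, _, hlt⟩ := hn (LinearMap.range Φ) (by
    rw [LinearMap.finrank_range_of_inj hinj]; simp)
  have h1 := hΦ a
  have : c / D * ‖Φ a‖ ≤ c * Real.sqrt (∑ i, ‖a i‖ ^ 2) := by
    rw [div_mul_eq_mul_div, div_le_iff₀ hD]
    calc c * ‖Φ a‖ ≤ c * (D * Real.sqrt (∑ i, ‖a i‖ ^ 2)) := by gcongr; exact h1.1
      _ = _ := by ring
  linarith [h1.2]

lemma not_radSmall_of {𝕜 X Y : Type*} [RCLike 𝕜]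
    [NormedAddCommGroup X] [NormedSpace 𝕜 X] [NormedAddCommGroup Y] [NormedSpace 𝕜 Y]
    (T : X →L[𝕜] Y) (c D : ℝ) (hc : 0 < c) (hD : 0 < D)
    (h : ∀ k : ℕ, ∃ Φ : (Fin k → 𝕜) →ₗ[𝕜] X, ∀ a,
        ‖Φ a‖ ≤ D * Real.sqrt (∑ i, ‖a i‖ ^ 2) ∧ c * Real.sqrt (∑ i, ‖a i‖ ^ 2) ≤ ‖T (Φ a)‖) :
    ¬ RadSmall T := by
  intro hT
  obtain ⟨k0, hk0⟩ := hT (c / D / 2) (by positivity)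
  set k := k0 + 1 with hk
  have hkpos : (0:ℝ) < k := by rw [hk]; positivity
  obtain ⟨Φ, hΦ⟩ := h k
  have hlin : ∀ a : Fin k → ℝ, ∑ i, (a i : 𝕜) • (((D⁻¹ : ℝ) : 𝕜) • Φ (Pi.single i 1))
      = ((D⁻¹ : ℝ) : 𝕜) • Φ (fun i => (a i : 𝕜)) := by
    intro a
    have : (fun i => (a i : 𝕜)) = ∑ i, (a i : 𝕜) • (Pi.single i 1 : Fin k → 𝕜) := by
      funext u
      rw [Finset.sum_apply, Finset.sum_eq_single u]
      · rw [Pi.smul_apply, Pi.single_eq_same, smul_eq_mul, mul_one]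
      · intro b _ hb
        rw [Pi.smul_apply, Pi.single_eq_of_ne hb.symm, smul_zero]
      · simp
    rw [this, map_sum, Finset.smul_sum]
    exact Finset.sum_congr rfl fun i _ => by rw [map_smul, smul_comm]
  have hsq : ∀ a : Fin k → ℝ, ∑ i, ‖((a i : ℝ) : 𝕜)‖ ^ 2 = ∑ i, a i ^ 2 := fun a =>
    Finset.sum_congr rfl fun i _ => by rw [RCLike.norm_ofReal, sq_abs]
  have hb := hk0 k (by omega) (fun i => ((D⁻¹ : ℝ) : 𝕜) • Φ (Pi.single i 1)) (by
    intro a ha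
    rw [hlin, norm_smul, RCLike.norm_ofReal, abs_of_pos (by positivity), inv_mul_le_iff₀ hD]
    refine ((hΦ _).1).trans ?_
    rw [hsq]
    gcongr
    exact Real.sqrt_le_iff.2 ⟨zero_le_one, by simpa using ha⟩)
  have hlow : ∀ s : Finset (Fin k), c / D * Real.sqrt k ≤
      ‖T (∑ i, (rad i s : 𝕜) • (((D⁻¹ : ℝ) : 𝕜) • Φ (Pi.single i 1)))‖ := by
    intro s
    rw [hlin, map_smul, norm_smul, RCLike.norm_ofReal, abs_of_pos (by positivity)]
    have h1 := (hΦ (fun i => (rad i s : 𝕜))).2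
    rw [hsq] at h1
    have h2 : ∑ i, rad i s ^ 2 = (k:ℝ) := by
      have : ∀ i, rad i s ^ 2 = 1 := fun i => by rw [sq, rad_mul_self]
      simp [this]
    rw [h2] at h1
    calc c / D * Real.sqrt k = D⁻¹ * (c * Real.sqrt k) := by field_simp
      _ ≤ _ := by gcongr
  have hsum := Finset.sum_le_sum (s := Finset.univ) fun s _ => hlow s
  have hcard : ((Finset.univ : Finset (Finset (Fin k))).card : ℝ) = 2 ^ k := by simp
  rw [Finset.sum_const, nsmul_eq_mul, hcard] at hsum
  have hfin := hsum.trans hb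
  have hs : 0 < Real.sqrt k := Real.sqrt_pos.2 hkpos
  have : 0 < c / D * (Real.sqrt k * 2 ^ k) := by positivity
  nlinarith

lemma radIdeal_subideal (𝕜 X Y : Type*) [RCLike 𝕜]
    [NormedAddCommGroup X] [NormedSpace 𝕜 X] [NormedAddCommGroup Y] [NormedSpace 𝕜 Y] :
    IsClosedSubideal (radIdeal 𝕜 X Y) :=
  ⟨radIdeal_closed, fun T hT A B =>
    RadSmall.comp_left (RadSmall.comp_right (show RadSmall T from hT) A) B⟩

lemma closedSpan_subideal (𝕜 X Y : Type*) [RCLike 𝕜]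
    [NormedAddCommGroup X] [NormedSpace 𝕜 X] [NormedAddCommGroup Y] [NormedSpace 𝕜 Y] :
    IsClosedSubideal (closedSpanHilbertFactorable 𝕜 X Y) := by
  refine ⟨Submodule.isClosed_topologicalClosure _, fun T hT A B => ?_⟩
  let F : (X →L[𝕜] Y) →ₗ[𝕜] (X →L[𝕜] Y) :=
    { toFun := fun R => B.comp (R.comp A)
      map_add' := fun R1 R2 => by ext x; simp
      map_smul' := fun r R => by ext x; simp }
  have hF : Continuous F := by
    change Continuous fun R : X →L[𝕜] Y => B.comp (R.comp A)
    exact continuous_const.clm_comp (continuous_id.clm_comp continuous_const)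
  have hmap : ∀ R ∈ Submodule.span 𝕜 {T : X →L[𝕜] Y | FactorsThroughEllTwo T},
      F R ∈ Submodule.span 𝕜 {T : X →L[𝕜] Y | FactorsThroughEllTwo T} := by
    intro R hR
    induction hR using Submodule.span_induction with
    | mem R h =>
      obtain ⟨A', B', rfl⟩ := h
      exact Submodule.subset_span ⟨A'.comp A, B.comp B', rfl⟩
    | zero => rw [map_zero]; exact Submodule.zero_mem _
    | add R1 R2 _ _ h1 h2 => rw [map_add]; exact Submodule.add_mem _ h1 h2
    | smul c R _ h => rw [map_smul]; exact Submodule.smul_mem _ _ h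
  have hT' : T ∈ closure (Submodule.span 𝕜 {T : X →L[𝕜] Y | FactorsThroughEllTwo T} : Set (X →L[𝕜] Y)) := hT
  have hfin := map_mem_closure hF hT' hmap
  exact hfin

/-- `1 < p < 2`, `1/p + 1/p' = 1`, `p' ≤ q ≤ ∞`; `X` contains a complemented
copy of `ℓ_p`, and `Y` contains an isomorphic copy of `ℓ_q` (if `q < ∞`) or of `c₀`
(if `q = ∞`).  Then there are `S, T ∈ L(X,Y)` with `S` finitely strictly singular but
outside the closed span of the `ℓ₂`-factorable operators, and `T` `ℓ₂`-factorable but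
not finitely strictly singular; consequently the closed subideals of `L(X,Y)` are not
linearly ordered by inclusion. -/
theorem statement12 (𝕜 : Type*) [RCLike 𝕜] (p p' : ℝ) (q : ℝ≥0∞)
    (hp1 : 1 < p) (hp2 : p < 2) (hconj : 1 / p + 1 / p' = 1) (hq : ENNReal.ofReal p' ≤ q)
    [Fact (1 ≤ ENNReal.ofReal p)] [Fact (1 ≤ q)]
    (X : Type*) [NormedAddCommGroup X] [NormedSpace 𝕜 X] [CompleteSpace X]
    (Y : Type*) [NormedAddCommGroup Y] [NormedSpace 𝕜 Y] [CompleteSpace Y]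
    (hcompl : ∃ (P : X →L[𝕜] lp (fun _ : ℕ => 𝕜) (ENNReal.ofReal p))
        (Q : lp (fun _ : ℕ => 𝕜) (ENNReal.ofReal p) →L[𝕜] X), ∀ z, P (Q z) = z)
    (hcopy : (q ≠ ∞ ∧ ∃ (J : lp (fun _ : ℕ => 𝕜) q →L[𝕜] Y) (c : ℝ),
          0 < c ∧ ∀ z, c * ‖z‖ ≤ ‖J z‖)
        ∨ (q = ∞ ∧ ∃ (J : ZeroAtInftyContinuousMap ℕ 𝕜 →L[𝕜] Y) (c : ℝ),
          0 < c ∧ ∀ z, c * ‖z‖ ≤ ‖J z‖)) :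
    (∃ S T : X →L[𝕜] Y,
      (FinStrictSing S ∧ S ∉ closedSpanHilbertFactorable 𝕜 X Y) ∧
      (FactorsThroughEllTwo T ∧ ¬ FinStrictSing T)) ∧
    (∃ I J : Submodule 𝕜 (X →L[𝕜] Y), IsClosedSubideal I ∧ IsClosedSubideal J ∧
      ¬ (I : Set (X →L[𝕜] Y)) ⊆ J ∧ ¬ (J : Set (X →L[𝕜] Y)) ⊆ I) := by
  have hp0 : 0 < p := by linarith
  have hp'inv : 1 / p' = 1 - 1 / p := by linarith
  have hp1' : 1 / p < 1 := by rw [div_lt_one hp0]; exact hp1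
  have hpos : 0 < 1 / p' := by rw [hp'inv]; linarith
  have hp'0 : 0 < p' := one_div_pos.1 hpos
  have hc : p.HolderConjugate p' := by
    rw [Real.holderConjugate_iff]
    exact ⟨hp1, by rw [← one_div, ← one_div]; exact hconj⟩
  have hfact : Fact (1 ≤ ENNReal.ofReal p') :=
    ⟨by rw [ENNReal.one_le_ofReal]; exact hc.symm.lt.le⟩
  have hinf1 : Infinite (Σ m : ℕ, Finset (Fin m)) :=
    Infinite.of_injective (fun m => (⟨m, ∅⟩ : Σ m : ℕ, Finset (Fin m))) fun x y h => congrArg Sigma.fst h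
  have hinf2 : Infinite (Σ m : ℕ, Fin m) :=
    Infinite.of_injective (fun m : ℕ => (⟨m + 1, 0⟩ : Σ m : ℕ, Fin m)) fun x y h => by
      have := congrArg Sigma.fst h
      simpa using this
  obtain ⟨hd1⟩ := nonempty_denumerable (Σ m : ℕ, Finset (Fin m))
  obtain ⟨hd2⟩ := nonempty_denumerable (Σ m : ℕ, Fin m)
  obtain ⟨S, hS1, hS2, hS3⟩ := exists_S 𝕜 p p' q hp1 hp2 hc hq X Y hcompl hcopy
    (Denumerable.eqv (Σ m : ℕ, Finset (Fin m))).symm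
  obtain ⟨T, hT1, c, D, hcp, hD, hΦ⟩ := exists_T 𝕜 p p' q hp2 hc hq X Y hcompl hcopy
    (Denumerable.eqv (Σ m : ℕ, Finset (Fin m))).symm (Denumerable.eqv (Σ m : ℕ, Fin m)).symm
  have hTJ : T ∈ closedSpanHilbertFactorable 𝕜 X Y :=
    Submodule.le_topologicalClosure _ (Submodule.subset_span hT1)
  exact ⟨⟨S, T, ⟨hS1, hS3⟩, hT1, not_fss_of T c D hcp hD hΦ⟩,
    radIdeal 𝕜 X Y, closedSpanHilbertFactorable 𝕜 X Y, radIdeal_subideal 𝕜 X Y,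
    closedSpan_subideal 𝕜 X Y, fun h => hS3 (h hS2),
    fun h => not_radSmall_of T c D hcp hD hΦ (h hTJ)⟩

end
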